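/- arXiv:2306.14849 — 2 statements merged into one kernel-verified Lean document; each statement's English description precedes it below -/
import Mathlib

section
/- Fix T > 0 and λ > 0, and for each λ′ > 0 define φ_{λ′} : [0,T] → ℝ by φ_{λ′}(a) = ν((T−a)λ′) / ν((T−a)λ) for a ∈ [0,T) and φ_{λ′}(T) = 1. If μ₁ and μ₂ are finite Borel measures on the interval [0,T] such that ∫ φ_{λ′} dμ₁ = ∫ φ_{λ′} dμ₂ for every λ′ > 0, then μ₁ = μ₂. In other words, the family {φ_{λ′}}_{λ′ > 0} is a determining class on [0,T]. -/
open MeasureTheory Real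

/-- The Volterra function `ν(x) = ∫₀^∞ x^s / Γ(s+1) ds` (for `x > 0`; `ν(0) = 0`). -/
noncomputable def volterra (x : ℝ) : ℝ := ∫ s in Set.Ioi (0 : ℝ), x ^ s / Real.Gamma (s + 1)

/-- `φ_{λ′}(a) = ν((T−a)λ′) / ν((T−a)λ)` for `a ∈ [0,T)`, with `φ_{λ′}(T) = 1`
(values outside `[0,T]` are irrelevant for measures carried by `[0,T]`). -/
noncomputable def phiDet (T lam lam' a : ℝ) : ℝ :=
  if a < T then volterra ((T - a) * lam') / volterra ((T - a) * lam) else 1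

theorem hasSum_integral_of_unit_interval {E : Type*} [NormedAddCommGroup E] [NormedSpace ℝ E]
    {μ : Measure ℝ} [IsFiniteMeasure μ] (hμ : ∀ᵐ x ∂μ, x ∈ Set.Icc (0 : ℝ) 1)
    {F : ℕ → ℝ → E} {f : ℝ → E} {b : ℕ → ℝ} (hF : ∀ n, Continuous (F n))
    (hb : Summable b) (hFb : ∀ n, ∀ x ∈ Set.Icc (0 : ℝ) 1, ‖F n x‖ ≤ b n)
    (hf : ∀ x ∈ Set.Icc (0 : ℝ) 1, HasSum (fun n => F n x) (f x)) :
    HasSum (fun n => ∫ x, F n x ∂μ) (∫ x, f x ∂μ) :=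
  hasSum_integral_of_dominated_convergence (fun n _ => b n)
    (fun n => (hF n).aestronglyMeasurable)
    (fun n => hμ.mono fun x hx => hFb n x hx) (Filter.Eventually.of_forall fun _ => hb)
    (integrable_const _) (hμ.mono fun x hx => hf x hx)

/-- Finite measures carried by `[0,1]` are determined by their moments. -/
theorem measure_ext_of_moments {μ ν : Measure ℝ} [IsFiniteMeasure μ] [IsFiniteMeasure ν]
    (hμ : ∀ᵐ x ∂μ, x ∈ Set.Icc (0 : ℝ) 1) (hν : ∀ᵐ x ∂ν, x ∈ Set.Icc (0 : ℝ) 1)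
    (h : ∀ n : ℕ, ∫ x, x ^ n ∂μ = ∫ x, x ^ n ∂ν) : μ = ν := by
  refine Measure.ext_of_charFun (funext fun t => ?_)
  have key : ∀ ρ : Measure ℝ, IsFiniteMeasure ρ → (∀ᵐ x ∂ρ, x ∈ Set.Icc (0 : ℝ) 1) →
      HasSum (fun n : ℕ => ((t * Complex.I) ^ n / n.factorial) * ((∫ x, x ^ n ∂ρ : ℝ) : ℂ))
        (charFun ρ t) := by
    intro ρ _ hρ
    rw [charFun_apply_real]
    have := hasSum_integral_of_unit_interval hρ
      (F := fun n x => ((t * Complex.I) ^ n / n.factorial) * ((x ^ n : ℝ) : ℂ))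
      (f := fun x => Complex.exp (t * x * Complex.I))
      (b := fun n => |t| ^ n / n.factorial) (fun n => by fun_prop)
      (Real.summable_pow_div_factorial _) ?_ ?_
    · simpa only [integral_const_mul, integral_complex_ofReal] using this
    · intro n x hx
      have : |x| ^ n ≤ 1 := pow_le_one₀ (abs_nonneg _) (abs_le.2 ⟨by linarith [hx.1], hx.2⟩)
      have h2 : 0 ≤ |t| ^ n / n.factorial := by positivity
      simpa using mul_le_mul_of_nonneg_left this h2
    · intro x _
      have := NormedSpace.expSeries_div_hasSum_exp (𝔸 := ℂ) (t * x * Complex.I)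
      rw [← Complex.exp_eq_exp_ℂ] at this
      refine this.congr_fun fun n => ?_
      push_cast
      ring
  have h2 := key ν inferInstance hν
  simp_rw [← h] at h2
  exact (key μ inferInstance hμ).unique h2

/-- Finite measures carried by `[0,1]` are determined by their Stieltjes-type transform near `0`. -/
theorem measure_ext_of_integral_inv_one_add_mul {μ ν : Measure ℝ}
    [IsFiniteMeasure μ] [IsFiniteMeasure ν]
    (hμ : ∀ᵐ x ∂μ, x ∈ Set.Icc (0 : ℝ) 1) (hν : ∀ᵐ x ∂ν, x ∈ Set.Icc (0 : ℝ) 1)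
    (h : ∀ r : ℝ, |r| < 1 → ∫ x, (1 + r * x)⁻¹ ∂μ = ∫ x, (1 + r * x)⁻¹ ∂ν) : μ = ν := by
  refine measure_ext_of_moments hμ hν fun n => ?_
  have key : ∀ ρ : Measure ℝ, IsFiniteMeasure ρ → (∀ᵐ x ∂ρ, x ∈ Set.Icc (0 : ℝ) 1) →
      HasFPowerSeriesAt (fun r : ℝ => ∫ x, (1 + r * x)⁻¹ ∂ρ)
        (FormalMultilinearSeries.ofScalars ℝ fun n => (-1) ^ n * ∫ x, x ^ n ∂ρ) 0 := by
    intro ρ _ hρ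
    rw [hasFPowerSeriesAt_iff]
    filter_upwards [Metric.ball_mem_nhds (0 : ℝ) one_pos] with r hr
    have hr : |r| < 1 := by simpa using hr
    have hrx : ∀ x ∈ Set.Icc (0 : ℝ) 1, |(-r) * x| ≤ |r| := by
      intro x hx
      rw [abs_mul, abs_neg, abs_of_nonneg hx.1]
      exact mul_le_of_le_one_right (abs_nonneg _) hx.2
    have := hasSum_integral_of_unit_interval hρ (F := fun n x => ((-r) * x) ^ n)
      (f := fun x => (1 + r * x)⁻¹) (b := fun n => |r| ^ n) (fun n => by fun_prop)
      (summable_geometric_of_lt_one (abs_nonneg _) hr)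
      (fun n x hx => by
        rw [norm_pow, Real.norm_eq_abs]
        exact pow_le_pow_left₀ (abs_nonneg _) (hrx x hx) n)
      (fun x hx => by
        simpa using hasSum_geometric_of_abs_lt_one ((hrx x hx).trans_lt hr))
    simp only [zero_add, FormalMultilinearSeries.coeff_ofScalars, smul_eq_mul]
    convert! this using 2 with n
    simp_rw [mul_pow, integral_const_mul]
    rw [neg_pow]; ring
  have h1 := (key μ inferInstance hμ).eq_formalMultilinearSeries_of_eventually
    (key ν inferInstance hν) (by
      filter_upwards [Metric.ball_mem_nhds (0 : ℝ) one_pos] with r hr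
      exact h r (by simpa using hr))
  have h2 := congrArg (fun p => p.coeff n) h1
  simpa using h2

theorem continuousOn_Gamma_add_one : ContinuousOn (fun s : ℝ => Gamma (s + 1)) (Set.Ioi 0) := by
  intro s hs
  have hs : 0 < s := hs
  have := (differentiableAt_Gamma (s := s + 1) (fun m => by linarith [m.cast_nonneg (α := ℝ)])).continuousAt
  exact (ContinuousAt.comp (f := fun s : ℝ => s + 1) this (by fun_prop)).continuousWithinAt

/-- `Γ(s + 1)` cut off to be `0` for `s ≤ 0`. -/
noncomputable def gammaCut (s : ℝ) : ℝ := (Set.Ioi (0 : ℝ)).indicator (fun s => Gamma (s + 1)) s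

theorem measurable_gammaCut : Measurable gammaCut := by
  have := ContinuousOn.measurable_piecewise continuousOn_Gamma_add_one
    (g := 0) continuousOn_const measurableSet_Ioi
  rwa [Set.piecewise_eq_indicator] at this

theorem volterra_eq (x : ℝ) : volterra x = ∫ s in Set.Ioi (0 : ℝ), x ^ s / gammaCut s :=
  setIntegral_congr_fun measurableSet_Ioi fun s hs => by
    simp only [gammaCut, Set.indicator_of_mem hs]

theorem measurable_volterra : Measurable volterra := by
  have h : StronglyMeasurable fun x => ∫ s in Set.Ioi (0 : ℝ), x ^ s / gammaCut s := by
    refine StronglyMeasurable.integral_prod_right' (f := fun z : ℝ × ℝ => z.1 ^ z.2 / gammaCut z.2) ?_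
    exact ((measurable_fst.pow measurable_snd).div
      (measurable_gammaCut.comp measurable_snd)).stronglyMeasurable
  rw [funext volterra_eq]
  exact h.measurable

theorem volterra_nonneg {x : ℝ} (hx : 0 ≤ x) : 0 ≤ volterra x :=
  setIntegral_nonneg measurableSet_Ioi fun s hs =>
    div_nonneg (rpow_nonneg hx _) (Gamma_pos_of_pos (by linarith [Set.mem_Ioi.1 hs])).le

theorem integral_laplace_rpow_div_Gamma {p s : ℝ} (hp : 0 < p) (hs : 0 < s) :
    ∫ x in Set.Ioi (0 : ℝ), exp (-(p * x)) * (x ^ s / Gamma (s + 1)) =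
      p⁻¹ * exp (-(log p * s)) := by
  have hG := (Gamma_pos_of_pos (by linarith : 0 < s + 1)).ne'
  have h := integral_rpow_mul_exp_neg_mul_Ioi (by linarith : 0 < s + 1) hp
  have h2 : ∀ x, exp (-(p * x)) * (x ^ s / Gamma (s + 1)) =
      (Gamma (s + 1))⁻¹ * (x ^ (s + 1 - 1) * exp (-(p * x))) := by
    intro x; rw [add_sub_cancel_right]; ring
  simp_rw [h2]
  rw [integral_const_mul, h, one_div, inv_rpow hp.le, ← rpow_neg hp.le, rpow_def_of_pos hp]
  rw [mul_comm _ (Gamma _), inv_mul_cancel_left₀ hG,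
    show log p * -(s + 1) = -log p + -(log p * s) by ring, exp_add, exp_neg (log p), exp_log hp]

theorem integrable_laplace_rpow_div_Gamma {p : ℝ} (hp : 1 < p) :
    Integrable (fun z : ℝ × ℝ => exp (-(p * z.1)) * (z.1 ^ z.2 / gammaCut z.2))
      ((volume.restrict (Set.Ioi 0)).prod (volume.restrict (Set.Ioi 0))) := by
  have hp0 : 0 < p := by linarith
  rw [integrable_prod_iff']
  · constructor
    · filter_upwards [ae_restrict_mem measurableSet_Ioi] with s hs
      have hs : 0 < s := hs
      have := (integrableOn_rpow_mul_exp_neg_mul_rpow (p := 1) (s := s) (by linarith)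
        one_pos hp0).mul_const (gammaCut s)⁻¹
      refine this.congr (Filter.Eventually.of_forall fun x => ?_)
      simp only [rpow_one, neg_mul]; ring
    · have := (exp_neg_integrableOn_Ioi 0 (log_pos hp)).const_mul p⁻¹
      refine this.congr ?_
      filter_upwards [ae_restrict_mem measurableSet_Ioi] with s hs
      rw [neg_mul, ← integral_laplace_rpow_div_Gamma hp0 hs]
      refine setIntegral_congr_fun measurableSet_Ioi fun x hx => ?_
      have hG := Gamma_pos_of_pos (by linarith [Set.mem_Ioi.1 hs] : 0 < s + 1)
      have hx : 0 < x := hx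
      simp only [gammaCut, Set.indicator_of_mem hs]
      rw [norm_of_nonneg (by positivity)]
  · refine Measurable.aestronglyMeasurable ?_
    exact (by fun_prop : Measurable fun z : ℝ × ℝ => exp (-(p * z.1))).mul
      ((measurable_fst.pow measurable_snd).div (measurable_gammaCut.comp measurable_snd))

theorem integrableOn_laplace_volterra {p : ℝ} (hp : 1 < p) :
    IntegrableOn (fun x => exp (-(p * x)) * volterra x) (Set.Ioi 0) := by
  refine (integrable_laplace_rpow_div_Gamma hp).integral_prod_left.congr
    (Filter.Eventually.of_forall fun x => ?_)
  simp only
  rw [integral_const_mul, volterra_eq]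

theorem integral_laplace_volterra {p : ℝ} (hp : 1 < p) :
    ∫ x in Set.Ioi (0 : ℝ), exp (-(p * x)) * volterra x = (p * log p)⁻¹ := by
  have hp0 : 0 < p := by linarith
  have h := integral_integral_swap (f := fun x s => exp (-(p * x)) * (x ^ s / gammaCut s))
    (integrable_laplace_rpow_div_Gamma hp)
  simp_rw [integral_const_mul, ← volterra_eq] at h
  rw [h, setIntegral_congr_fun (g := fun s => p⁻¹ * exp (-log p * s)) measurableSet_Ioi]
  · rw [integral_const_mul, integral_exp_mul_Ioi (by linarith [log_pos hp])]
    simp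
    ring
  · intro s hs
    simp only [gammaCut, Set.indicator_of_mem hs]
    rw [integral_laplace_rpow_div_Gamma hp0 hs, neg_mul]

theorem integrableOn_laplace_volterra_mul {p w : ℝ} (hw : 0 < w) (hp : w < p) :
    IntegrableOn (fun x => exp (-(p * x)) * volterra (w * x)) (Set.Ioi 0) := by
  have h := (integrableOn_Ioi_comp_mul_left_iff
    (fun x => exp (-(p / w * x)) * volterra x) 0 hw).2
    (by simpa using integrableOn_laplace_volterra ((one_lt_div hw).2 hp))
  refine h.congr_fun (fun x _ => ?_) measurableSet_Ioi
  simp only [← mul_assoc, div_mul_cancel₀ p hw.ne']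

theorem integral_laplace_volterra_mul {p w : ℝ} (hw : 0 < w) (hp : w < p) :
    ∫ x in Set.Ioi (0 : ℝ), exp (-(p * x)) * volterra (w * x) = (p * log (p / w))⁻¹ := by
  have h := integral_comp_mul_left_Ioi (fun x => exp (-(p / w * x)) * volterra x) 0 hw
  simp only [← mul_assoc, div_mul_cancel₀ p hw.ne', mul_zero] at h
  rw [h, integral_laplace_volterra ((one_lt_div hw).2 hp), smul_eq_mul, ← mul_inv]
  congr 1
  field_simp

theorem integrableOn_rpow_div_Gamma {y : ℝ} (hy : 0 < y) :
    IntegrableOn (fun s => y ^ s / Gamma (s + 1)) (Set.Ioi 0) := by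
  have h := (integrable_laplace_rpow_div_Gamma one_lt_two).prod_right_ae
  rw [ae_restrict_iff' measurableSet_Ioi] at h
  have h3 : ∃ x, x ∈ Set.Ioi y ∧ (x ∈ Set.Ioi (0 : ℝ) → Integrable
      (fun s => exp (-(2 * x)) * (x ^ s / gammaCut s)) (volume.restrict (Set.Ioi 0))) := by
    have : ∃ᵐ x : ℝ, x ∈ Set.Ioi y := by
      rw [frequently_ae_mem_iff]; simp
    exact (this.and_eventually h).exists
  obtain ⟨x, hx, hi⟩ := h3
  have hx : y < x := hx
  have hi := (hi (hy.trans hx)).const_mul (exp (2 * x))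
  refine Integrable.mono' hi ?_ ?_
  · refine ContinuousOn.aestronglyMeasurable (fun s hs => ?_) measurableSet_Ioi
    have hs' : 0 < s := hs
    exact (continuousAt_const_rpow hy.ne').continuousWithinAt.div
      (continuousOn_Gamma_add_one s hs) (Gamma_pos_of_pos (by linarith)).ne'
  · filter_upwards [ae_restrict_mem measurableSet_Ioi] with s hs
    have hs' : 0 < s := hs
    have hG := Gamma_pos_of_pos (by linarith : 0 < s + 1)
    simp only [gammaCut, Set.indicator_of_mem hs]
    rw [norm_of_nonneg (by positivity), ← mul_assoc, ← exp_add, add_neg_cancel, exp_zero, one_mul]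
    gcongr

theorem Gamma_add_one_le_one {s : ℝ} (h0 : 0 ≤ s) (h1 : s ≤ 1) : Gamma (s + 1) ≤ 1 := by
  have h := convexOn_Gamma.2 (x := 1) (y := 2) (by simp) (by simp) (sub_nonneg.2 h1) h0 (by ring)
  simp only [smul_eq_mul, Gamma_one, Gamma_two] at h
  convert! h using 2 <;> ring

theorem le_volterra {Y u : ℝ} (hY : 0 < Y) (hu : 0 ≤ u) :
    min 1 Y * exp (-1) / (1 + u) ≤ volterra (Y * exp (-u)) := by
  have hy : 0 < Y * exp (-u) := by positivity
  have hi := integrableOn_rpow_div_Gamma hy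
  have hsub : Set.Ioc (0 : ℝ) (1 + u)⁻¹ ⊆ Set.Ioi 0 := Set.Ioc_subset_Ioi_self
  calc min 1 Y * exp (-1) / (1 + u)
      = ∫ s in Set.Ioc (0 : ℝ) (1 + u)⁻¹, min 1 Y * exp (-1) := by
        simp [div_eq_inv_mul, max_eq_left (by positivity : 0 ≤ (1 + u)⁻¹)]
    _ ≤ ∫ s in Set.Ioc (0 : ℝ) (1 + u)⁻¹, (Y * exp (-u)) ^ s / Gamma (s + 1) := by
        refine setIntegral_mono_on (integrableOn_const (by simp)) (hi.mono_set hsub) measurableSet_Ioc fun s hs => ?_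
        have hs1 : s ≤ 1 := hs.2.trans (inv_le_one_of_one_le₀ (by linarith))
        have hs2 : u * s ≤ 1 := by
          have := (le_inv_comm₀ hs.1 (by linarith)).1 hs.2
          have h3 : (1 + u) * s ≤ 1 := by
            calc (1 + u) * s ≤ s⁻¹ * s := by gcongr; exact hs.1.le
              _ = 1 := inv_mul_cancel₀ hs.1.ne'
          linarith [hs.1]
        have hG := Gamma_pos_of_pos (by linarith [hs.1] : 0 < s + 1)
        refine le_trans ?_ (le_div_self (rpow_nonneg hy.le s) hG (Gamma_add_one_le_one hs.1.le hs1))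
        rw [mul_rpow hY.le (exp_nonneg _), ← exp_mul]
        gcongr
        · rcases le_total Y 1 with h | h
          · rw [min_eq_right h]
            simpa using rpow_le_rpow_of_exponent_ge hY h hs1
          · rw [min_eq_left h]
            exact one_le_rpow h hs.1.le
        · linarith
    _ ≤ volterra (Y * exp (-u)) := by
        refine setIntegral_mono_set hi ?_ hsub.eventuallyLE
        filter_upwards [ae_restrict_mem measurableSet_Ioi] with s hs
        have hs' : 0 < s := hs
        have hG := Gamma_pos_of_pos (by linarith : 0 < s + 1)
        simp only [Pi.zero_apply]
        positivity

/-- The coordinate `1 / (1 + log (T / (T - a)))`, which maps `[0,T]` onto `[0,1]`. -/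
noncomputable def logCoord (T a : ℝ) : ℝ := if a < T then (1 + log (T / (T - a)))⁻¹ else 0

/-- The inverse of `logCoord T` on `[0,1]`. -/
noncomputable def logCoordInv (T x : ℝ) : ℝ := if x = 0 then T else T - T / exp (x⁻¹ - 1)

/-- The bounded weight relating Laplace transforms of `phiDet` to powers of `logCoord`. -/
noncomputable def laplaceWeight (T lam a : ℝ) : ℝ :=
  if a < T then logCoord T a / volterra ((T - a) * lam) else 1

theorem measurable_logCoord (T : ℝ) : Measurable (logCoord T) :=
  Measurable.ite measurableSet_Iio (by fun_prop) (by fun_prop)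

theorem measurable_logCoordInv (T : ℝ) : Measurable (logCoordInv T) :=
  Measurable.ite (measurableSet_singleton 0) (by fun_prop) (by fun_prop)

theorem measurable_laplaceWeight (T lam : ℝ) : Measurable (laplaceWeight T lam) :=
  Measurable.ite measurableSet_Iio
    ((measurable_logCoord T).div (measurable_volterra.comp (by fun_prop))) (by fun_prop)

theorem log_div_sub_nonneg {T a : ℝ} (ha0 : 0 ≤ a) (haT : a < T) : 0 ≤ log (T / (T - a)) :=
  log_nonneg ((one_le_div (by linarith)).2 (by linarith))

theorem logCoord_mem {T a : ℝ} (ha : a ∈ Set.Icc 0 T) : logCoord T a ∈ Set.Icc (0 : ℝ) 1 := by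
  unfold logCoord
  split_ifs with h
  · have := log_div_sub_nonneg ha.1 h
    exact ⟨by positivity, inv_le_one_of_one_le₀ (by linarith)⟩
  · simp

theorem logCoordInv_logCoord {T a : ℝ} (ha : a ∈ Set.Icc 0 T) :
    logCoordInv T (logCoord T a) = a := by
  unfold logCoord
  split_ifs with h
  · have := log_div_sub_nonneg ha.1 h
    have hT : 0 < T := ha.1.trans_lt h
    have h2 : 0 < T - a := by linarith
    rw [logCoordInv, if_neg (by positivity), inv_inv, add_sub_cancel_left, exp_log (by positivity)]
    field_simp
    ring
  · simp only [logCoordInv, if_true]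
    linarith [ha.2]

theorem le_volterra_sub_mul {T lam a : ℝ} (hlam : 0 < lam) (ha0 : 0 ≤ a) (haT : a < T) :
    min 1 (T * lam) * exp (-1) * logCoord T a ≤ volterra ((T - a) * lam) := by
  have hT : 0 < T := ha0.trans_lt haT
  have h2 : 0 < T - a := by linarith
  have h := le_volterra (mul_pos hT hlam) (log_div_sub_nonneg ha0 haT)
  rw [exp_neg (log _), exp_log (by positivity)] at h
  rw [logCoord, if_pos haT, ← div_eq_mul_inv]
  convert! h using 2
  field_simp

theorem volterra_sub_mul_pos {T lam a : ℝ} (hlam : 0 < lam) (ha0 : 0 ≤ a) (haT : a < T) :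
    0 < volterra ((T - a) * lam) := by
  refine lt_of_lt_of_le ?_ (le_volterra_sub_mul hlam ha0 haT)
  have hT : 0 < T := ha0.trans_lt haT
  have := log_div_sub_nonneg ha0 haT
  rw [logCoord, if_pos haT]
  positivity

theorem laplaceWeight_pos {T lam a : ℝ} (hlam : 0 < lam) (ha : a ∈ Set.Icc 0 T) :
    0 < laplaceWeight T lam a := by
  unfold laplaceWeight
  split_ifs with h
  · have := volterra_sub_mul_pos hlam ha.1 h
    have := log_div_sub_nonneg ha.1 h
    rw [logCoord, if_pos h]
    positivity
  · exact one_pos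

theorem exists_laplaceWeight_le {T lam : ℝ} (hT : 0 < T) (hlam : 0 < lam) :
    ∃ C, ∀ a ∈ Set.Icc 0 T, laplaceWeight T lam a ≤ C := by
  have hc : 0 < min 1 (T * lam) * exp (-1) := by positivity
  refine ⟨max (min 1 (T * lam) * exp (-1))⁻¹ 1, fun a ha => ?_⟩
  unfold laplaceWeight
  split_ifs with h
  · refine le_max_of_le_left ?_
    rw [div_le_iff₀ (volterra_sub_mul_pos hlam ha.1 h), ← div_eq_inv_mul, le_div_iff₀' hc]
    exact le_volterra_sub_mul hlam ha.1 h
  · exact le_max_right _ _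

theorem measurable_phiDet (T lam : ℝ) : Measurable fun z : ℝ × ℝ => phiDet T lam z.1 z.2 :=
  Measurable.ite (measurableSet_lt measurable_snd measurable_const)
    ((measurable_volterra.comp (by fun_prop)).div (measurable_volterra.comp (by fun_prop)))
    measurable_const

theorem phiDet_nonneg {T lam x a : ℝ} (hlam : 0 < lam) (hx : 0 < x) : 0 ≤ phiDet T lam x a := by
  unfold phiDet
  split_ifs with h
  · have : 0 < T - a := sub_pos.2 h
    exact div_nonneg (volterra_nonneg (by positivity)) (volterra_nonneg (by positivity))
  · exact zero_le_one

theorem integrableOn_laplace_phiDet {T lam p a : ℝ} (ha : a ∈ Set.Icc 0 T) (hT : 0 < T)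
    (hp : T < p) : IntegrableOn (fun x => exp (-(p * x)) * phiDet T lam x a) (Set.Ioi 0) := by
  unfold phiDet
  split_ifs with h
  · have := (integrableOn_laplace_volterra_mul (sub_pos.2 h) (by linarith [ha.1] : T - a < p)).div_const
      (volterra ((T - a) * lam))
    simpa only [mul_div_assoc, IntegrableOn] using this
  · simpa using exp_neg_integrableOn_Ioi 0 (hT.trans hp)

theorem integral_laplace_phiDet {T lam r a : ℝ} (ha : a ∈ Set.Icc 0 T) (hT : 0 < T) (hr : -1 < r) :
    ∫ x in Set.Ioi (0 : ℝ), exp (-(T * exp (1 + r) * x)) * phiDet T lam x a =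
      (T * exp (1 + r))⁻¹ * (laplaceWeight T lam a * (1 + r * logCoord T a)⁻¹) := by
  have hp : 0 < T * exp (1 + r) := by positivity
  have hp' : T < T * exp (1 + r) := lt_mul_of_one_lt_right hT (one_lt_exp_iff.2 (by linarith))
  unfold phiDet laplaceWeight logCoord
  split_ifs with h
  · have h2 : 0 < T - a := sub_pos.2 h
    have hu := log_div_sub_nonneg ha.1 h
    simp_rw [← mul_div_assoc]
    rw [integral_div, integral_laplace_volterra_mul h2 (by linarith [ha.1]), mul_div_right_comm,
      log_mul (by positivity) (exp_pos _).ne', log_exp]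
    have h3 : 1 + log (T / (T - a)) ≠ 0 := by positivity
    have h4 : 1 + r * (1 + log (T / (T - a)))⁻¹ =
        (log (T / (T - a)) + (1 + r)) / (1 + log (T / (T - a))) := by
      field_simp; ring
    rw [h4, inv_div, mul_inv]
    field_simp
  · have := integral_exp_mul_Ioi (neg_lt_zero.2 hp) 0
    simp only [neg_mul, mul_zero, exp_zero] at this
    simp [this]

theorem integral_laplaceWeight_eq {T lam : ℝ} (hT : 0 < T) (hlam : 0 < lam)
    {μ : Measure ℝ} [IsFiniteMeasure μ] (hμ : ∀ᵐ a ∂μ, a ∈ Set.Icc 0 T) {r : ℝ} (hr : |r| < 1) :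
    ∫ a, laplaceWeight T lam a * (1 + r * logCoord T a)⁻¹ ∂μ =
      T * exp (1 + r) * ∫ x in Set.Ioi (0 : ℝ), exp (-(T * exp (1 + r) * x)) *
        ∫ a, phiDet T lam x a ∂μ := by
  have hr' : -1 < r := (abs_lt.1 hr).1
  have hp : 0 < T * exp (1 + r) := by positivity
  have hp' : T < T * exp (1 + r) := lt_mul_of_one_lt_right hT (one_lt_exp_iff.2 (by linarith))
  obtain ⟨C, hC⟩ := exists_laplaceWeight_le hT hlam
  have hbound : Integrable (fun a => laplaceWeight T lam a * (1 + r * logCoord T a)⁻¹) μ := by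
    refine Integrable.of_bound (C := C * (1 - |r|)⁻¹) ?_ ?_
    · exact ((measurable_laplaceWeight T lam).mul
        (((measurable_logCoord T).const_mul r).const_add 1).inv).aestronglyMeasurable
    · filter_upwards [hμ] with a ha
      have h1 := laplaceWeight_pos hlam ha
      have h2 := logCoord_mem ha
      have h3 : 1 - |r| ≤ 1 + r * logCoord T a := by
        have := neg_abs_le r
        nlinarith [h2.1, h2.2, abs_nonneg r]
      have h4 : 0 < 1 - |r| := by linarith
      have h5 : 0 < 1 + r * logCoord T a := by linarith
      rw [norm_of_nonneg (by positivity)]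
      have := hC a ha
      gcongr
      exact h1.le.trans this
  have hprod : Integrable
      (Function.uncurry fun x a => exp (-(T * exp (1 + r) * x)) * phiDet T lam x a)
      ((volume.restrict (Set.Ioi 0)).prod μ) := by
    rw [integrable_prod_iff']
    · refine ⟨hμ.mono fun a ha => integrableOn_laplace_phiDet ha hT hp', ?_⟩
      refine (hbound.const_mul (T * exp (1 + r))⁻¹).congr ?_
      filter_upwards [hμ] with a ha
      rw [← integral_laplace_phiDet ha hT hr']
      refine setIntegral_congr_fun measurableSet_Ioi fun x hx => ?_
      exact (norm_of_nonneg (mul_nonneg (exp_nonneg _) (phiDet_nonneg hlam hx))).symm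
    · exact ((by fun_prop : Measurable fun z : ℝ × ℝ => exp (-(T * exp (1 + r) * z.1))).mul
        (measurable_phiDet T lam)).aestronglyMeasurable
  simp_rw [← integral_const_mul (exp _)]
  rw [integral_integral_swap hprod, integral_congr_ae (hμ.mono fun a ha =>
    integral_laplace_phiDet ha hT hr'), integral_const_mul, mul_inv_cancel_left₀ hp.ne']

theorem map_logCoordInv_map_logCoord {T : ℝ} {ρ : Measure ℝ} (hρ : ∀ᵐ a ∂ρ, a ∈ Set.Icc 0 T) :
    (ρ.map (logCoord T)).map (logCoordInv T) = ρ := by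
  rw [Measure.map_map (measurable_logCoordInv T) (measurable_logCoord T),
    Measure.map_congr (f := logCoordInv T ∘ logCoord T) (g := id)
      (hρ.mono fun a ha => logCoordInv_logCoord ha), Measure.map_id]

/-- The family `{φ_{λ′}}_{λ′>0}` is a determining class on `[0,T]`: two finite Borel measures
carried by `[0,T]` that integrate every `φ_{λ′}` equally must coincide. -/
theorem phiDet_determining_class (T lam : ℝ) (hT : 0 < T) (hlam : 0 < lam)
    (μ₁ μ₂ : Measure ℝ) [IsFiniteMeasure μ₁] [IsFiniteMeasure μ₂]
    (hμ₁ : μ₁ (Set.Icc 0 T)ᶜ = 0) (hμ₂ : μ₂ (Set.Icc 0 T)ᶜ = 0)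
    (h : ∀ lam' : ℝ, 0 < lam' →
      (∫ a, phiDet T lam lam' a ∂μ₁) = ∫ a, phiDet T lam lam' a ∂μ₂) :
    μ₁ = μ₂ := by
  have h₁ : ∀ᵐ a ∂μ₁, a ∈ Set.Icc 0 T := hμ₁
  have h₂ : ∀ᵐ a ∂μ₂, a ∈ Set.Icc 0 T := hμ₂
  obtain ⟨C, hC⟩ := exists_laplaceWeight_le hT hlam
  let g : ℝ → ENNReal := fun a => ENNReal.ofReal (laplaceWeight T lam a)
  have hg : Measurable g := (measurable_laplaceWeight T lam).ennreal_ofReal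
  have hfin : ∀ μ : Measure ℝ, IsFiniteMeasure μ → (∀ᵐ a ∂μ, a ∈ Set.Icc 0 T) →
      IsFiniteMeasure (μ.withDensity g) := fun μ _ hμ =>
    isFiniteMeasure_withDensity_ofReal
      (Integrable.of_bound (C := C) (measurable_laplaceWeight T lam).aestronglyMeasurable
        (hμ.mono fun a ha => by
          rw [norm_of_nonneg (laplaceWeight_pos hlam ha).le]; exact hC a ha)).2
  have hsupp : ∀ μ : Measure ℝ, (∀ᵐ a ∂μ, a ∈ Set.Icc 0 T) →
      ∀ᵐ a ∂μ.withDensity g, a ∈ Set.Icc 0 T := fun μ hμ =>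
    (withDensity_absolutelyContinuous μ g).ae_le hμ
  have hmap : ∀ μ : Measure ℝ, (∀ᵐ a ∂μ, a ∈ Set.Icc 0 T) →
      ∀ᵐ x ∂(μ.withDensity g).map (logCoord T), x ∈ Set.Icc (0 : ℝ) 1 := fun μ hμ =>
    (ae_map_iff (measurable_logCoord T).aemeasurable measurableSet_Icc).2
      ((hsupp μ hμ).mono fun a ha => logCoord_mem ha)
  have hinv : ∀ μ : Measure ℝ, (∀ᵐ a ∂μ, a ∈ Set.Icc 0 T) →
      (μ.withDensity g).withDensity g⁻¹ = μ := fun μ hμ =>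
    withDensity_inv_same hg
      (hμ.mono fun a ha => by simpa [g] using laplaceWeight_pos hlam ha)
      (Filter.Eventually.of_forall fun a => ENNReal.ofReal_ne_top)
  have hstieltjes : ∀ μ : Measure ℝ, IsFiniteMeasure μ → (∀ᵐ a ∂μ, a ∈ Set.Icc 0 T) →
      ∀ r : ℝ, |r| < 1 → ∫ x, (1 + r * x)⁻¹ ∂(μ.withDensity g).map (logCoord T) =
        T * exp (1 + r) * ∫ x in Set.Ioi (0 : ℝ), exp (-(T * exp (1 + r) * x)) *
          ∫ a, phiDet T lam x a ∂μ := by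
    intro μ _ hμ r hr
    rw [← integral_laplaceWeight_eq hT hlam hμ hr,
      integral_map (measurable_logCoord T).aemeasurable
        (Measurable.aestronglyMeasurable (by fun_prop)),
      integral_withDensity_eq_integral_toReal_smul hg
        (Filter.Eventually.of_forall fun a => ENNReal.ofReal_lt_top)]
    refine integral_congr_ae (hμ.mono fun a ha => ?_)
    simp only [g, ENNReal.toReal_ofReal (laplaceWeight_pos hlam ha).le, smul_eq_mul]
  have := hfin μ₁ inferInstance h₁
  have := hfin μ₂ inferInstance h₂
  have hext : (μ₁.withDensity g).map (logCoord T) = (μ₂.withDensity g).map (logCoord T) := by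
    refine measure_ext_of_integral_inv_one_add_mul (hmap μ₁ h₁) (hmap μ₂ h₂) fun r hr => ?_
    rw [hstieltjes μ₁ inferInstance h₁ r hr, hstieltjes μ₂ inferInstance h₂ r hr]
    congr 1
    exact setIntegral_congr_fun measurableSet_Ioi fun x hx => by simp only [h x hx]
  rw [← hinv μ₁ h₁, ← hinv μ₂ h₂, ← map_logCoordInv_map_logCoord (hsupp μ₁ h₁),
    ← map_logCoordInv_map_logCoord (hsupp μ₂ h₂), hext]
end

section
/- (Semigroup property of the kernels f_t^λ) For all λ > 0, all 0 < t < T, and all x, z ∈ ℝ² with x ≠ 0 and z ≠ 0, one has ∫_{ℝ²} f_t^λ(x,y) · f_{T−t}^λ(y,z) dy = f_T^λ(x,z). -/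
open MeasureTheory Real

/-- The derivative of the Volterra function: `ν′(x) = ∫₀^∞ s x^{s−1} / Γ(s+1) ds` for `x > 0`. -/
noncomputable def volterraDeriv (x : ℝ) : ℝ :=
  ∫ s in Set.Ioi (0 : ℝ), s * x ^ (s - 1) / Real.Gamma (s + 1)

/-- The two-dimensional Gaussian density `g_t(x) = (1/(2πt)) e^{−|x|²/(2t)}`. -/
noncomputable def gauss2 (t : ℝ) (x : EuclideanSpace ℝ (Fin 2)) : ℝ :=
  (1 / (2 * Real.pi * t)) * Real.exp (-(‖x‖ ^ 2 / (2 * t)))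

/-- The kernel `h_t^λ(x,y) = 2πλ ∫∫_{0<r<s<t} g_r(x) ν′((s−r)λ) g_{t−s}(y) ds dr`. -/
noncomputable def hKer (t lam : ℝ) (x y : EuclideanSpace ℝ (Fin 2)) : ℝ :=
  2 * Real.pi * lam *
    ∫ r in Set.Ioo (0 : ℝ) t, ∫ s in Set.Ioo r t,
      gauss2 r x * volterraDeriv ((s - r) * lam) * gauss2 (t - s) y

/-- The kernel `f_t^λ(x,y) = g_t(x−y) + h_t^λ(x,y)`. -/
noncomputable def fKer (t lam : ℝ) (x y : EuclideanSpace ℝ (Fin 2)) : ℝ :=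
  gauss2 t (x - y) + hKer t lam x y

/-- Two finite measures whose moments along a random variable with values in `[0,1]` agree
have the same law along that variable. -/
lemma map_eq_of_forall_integral_pow_eq {Ω : Type*} [MeasurableSpace Ω] {μ ν : Measure Ω}
    [IsFiniteMeasure μ] [IsFiniteMeasure ν] {X : Ω → ℝ} (hX : Measurable X)
    (hXμ : ∀ᵐ ω ∂μ, |X ω| ≤ 1) (hXν : ∀ᵐ ω ∂ν, |X ω| ≤ 1)
    (h : ∀ n : ℕ, ∫ ω, X ω ^ n ∂μ = ∫ ω, X ω ^ n ∂ν) : μ.map X = ν.map X := by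
  have key : ∀ (ρ : Measure Ω) [IsFiniteMeasure ρ], (∀ᵐ ω ∂ρ, |X ω| ≤ 1) → ∀ z : ℂ,
      HasSum (fun n : ℕ => z ^ n / (n.factorial : ℂ) * ((∫ ω, X ω ^ n ∂ρ : ℝ) : ℂ))
        (ProbabilityTheory.complexMGF X ρ z) := by
    intro ρ _ hρ z
    have := hasSum_integral_of_dominated_convergence (μ := ρ)
      (F := fun (n : ℕ) ω => z ^ n / (n.factorial : ℂ) * ((X ω ^ n : ℝ) : ℂ))
      (f := fun ω => Complex.exp (z * X ω)) (fun n _ => ‖z‖ ^ n / n.factorial)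
      (fun n => by
        refine Measurable.aestronglyMeasurable ?_
        fun_prop)
      (fun n => by
        filter_upwards [hρ] with ω hω
        rw [norm_mul, norm_div, norm_pow, Complex.norm_real, norm_pow, Complex.norm_natCast]
        exact mul_le_of_le_one_right (by positivity) (pow_le_one₀ (norm_nonneg _) hω))
      (by
        filter_upwards with ω
        exact Real.summable_pow_div_factorial _)
      (integrable_const _)
      (by
        filter_upwards with ω
        have := NormedSpace.expSeries_div_hasSum_exp (z * X ω)
        rw [← Complex.exp_eq_exp_ℂ] at this
        refine (congrArg (HasSum · _) (funext fun n => ?_)).mp this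
        push_cast
        ring)
    refine (congrArg (HasSum · _) (funext fun n => ?_)).mp this
    rw [integral_const_mul]
    congr 1
    exact integral_ofReal
  refine Measure.ext_of_complexMGF_eq hX.aemeasurable hX.aemeasurable ?_
  ext z
  refine (key μ hXμ z).unique ?_
  simp only [h]
  exact key ν hXν z

/-- A nonnegative function on the half-line is determined by its Laplace transform along an
arithmetic progression. -/
lemma ae_eq_of_forall_lintegral_exp_eq {f g : ℝ → ENNReal} (hf : Measurable f) (hg : Measurable g)
    (c : ℝ)
    (hfin : ∫⁻ x in Set.Ioi 0, f x * ENNReal.ofReal (exp (-(c * x))) ≠ ⊤)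
    (h : ∀ n : ℕ, ∫⁻ x in Set.Ioi 0, f x * ENNReal.ofReal (exp (-((c + n) * x)))
      = ∫⁻ x in Set.Ioi 0, g x * ENNReal.ofReal (exp (-((c + n) * x)))) :
    ∀ᵐ x ∂(volume.restrict (Set.Ioi (0 : ℝ))), f x = g x := by
  set f' : ℝ → ENNReal := fun x => f x * ENNReal.ofReal (exp (-(c * x))) with hf'
  set g' : ℝ → ENNReal := fun x => g x * ENNReal.ofReal (exp (-(c * x))) with hg'
  have mf' : Measurable f' := by fun_prop
  have mg' : Measurable g' := by fun_prop
  have h0 := h 0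
  simp only [Nat.cast_zero, add_zero] at h0
  have hginf : ∫⁻ x in Set.Ioi 0, g' x ≠ ⊤ := by rw [hg', ← h0]; exact hfin
  set μ := (volume.restrict (Set.Ioi (0 : ℝ))).withDensity f'
  set ν := (volume.restrict (Set.Ioi (0 : ℝ))).withDensity g'
  have : IsFiniteMeasure μ := isFiniteMeasure_withDensity hfin
  have : IsFiniteMeasure ν := isFiniteMeasure_withDensity hginf
  have hX : Measurable (fun x : ℝ => exp (-x)) := by fun_prop
  have hbd : ∀ᵐ x ∂(volume.restrict (Set.Ioi (0 : ℝ))), |exp (-x)| ≤ 1 := by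
    filter_upwards [ae_restrict_mem measurableSet_Ioi] with x hx
    rw [abs_of_pos (exp_pos _)]
    exact exp_le_one_iff.mpr (by simpa using (le_of_lt hx))
  have hmap : μ.map (fun x => exp (-x)) = ν.map (fun x => exp (-x)) := by
    refine map_eq_of_forall_integral_pow_eq hX
      ((withDensity_absolutelyContinuous _ _).ae_le hbd)
      ((withDensity_absolutelyContinuous _ _).ae_le hbd) fun n => ?_
    rw [integral_eq_lintegral_of_nonneg_ae (Filter.Eventually.of_forall fun x => by positivity)
        (by fun_prop),
      integral_eq_lintegral_of_nonneg_ae (Filter.Eventually.of_forall fun x => by positivity)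
        (by fun_prop),
      lintegral_withDensity_eq_lintegral_mul _ mf' (by fun_prop),
      lintegral_withDensity_eq_lintegral_mul _ mg' (by fun_prop)]
    have e : ∀ x : ℝ, ENNReal.ofReal (exp (-(c * x))) * ENNReal.ofReal (exp (-x) ^ n)
        = ENNReal.ofReal (exp (-((c + n) * x))) := fun x => by
      rw [← ENNReal.ofReal_mul (by positivity), ← exp_nat_mul, ← exp_add]
      congr 2
      ring
    simp only [Pi.mul_apply, hf', hg', mul_assoc, e, h n]
  have hemb : MeasurableEmbedding (fun x : ℝ => exp (-x)) :=
    hX.measurableEmbedding fun x y hxy => by simpa using hxy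
  have hμν : μ = ν := hemb.map_injective hmap
  have := (withDensity_eq_iff mf'.aemeasurable mg'.aemeasurable hfin).mp hμν
  filter_upwards [this] with x hx
  exact (ENNReal.mul_left_inj (by simpa using exp_pos _) ENNReal.ofReal_ne_top).mp hx

lemma measurable_uncurry_volterraDeriv_integrand :
    Measurable (fun p : ℝ × ℝ => (Set.Ioi (0 : ℝ)).indicator
      (fun s => s * p.1 ^ (s - 1) / Real.Gamma (s + 1)) p.2) := by
  have hΓ : Measurable ((Set.Ioi (0 : ℝ)).piecewise (fun s => Real.Gamma (s + 1)) 1) := by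
    refine ContinuousOn.measurable_piecewise ?_ continuousOn_const measurableSet_Ioi
    intro s hs
    have h1 : ContinuousAt Real.Gamma (s + 1) :=
      (Real.differentiableAt_Gamma fun m hm => by
        have : (0 : ℝ) < s := hs
        have : (0 : ℝ) ≤ m := m.cast_nonneg
        linarith).continuousAt
    exact (ContinuousAt.comp (f := fun s : ℝ => s + 1) h1 (by fun_prop)).continuousWithinAt
  have : (fun p : ℝ × ℝ => (Set.Ioi (0 : ℝ)).indicator
      (fun s => s * p.1 ^ (s - 1) / Real.Gamma (s + 1)) p.2)
      = (Prod.snd ⁻¹' Set.Ioi (0 : ℝ)).indicator (fun p : ℝ × ℝ => p.2 * p.1 ^ (p.2 - 1) /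
        (Set.Ioi (0 : ℝ)).piecewise (fun s => Real.Gamma (s + 1)) 1 p.2) := by
    ext p
    by_cases hp : p.2 ∈ Set.Ioi (0 : ℝ)
    · rw [Set.indicator_of_mem hp, Set.indicator_of_mem (by exact hp),
        Set.piecewise_eq_of_mem _ _ _ hp]
    · rw [Set.indicator_of_notMem hp, Set.indicator_of_notMem (by exact hp)]
  rw [this]
  refine Measurable.indicator ?_ (measurable_snd measurableSet_Ioi)
  exact (by fun_prop : Measurable fun p : ℝ × ℝ => p.2 * p.1 ^ (p.2 - 1)).div
    (hΓ.comp measurable_snd)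

lemma volterraDeriv_eq_integral_indicator (x : ℝ) :
    volterraDeriv x = ∫ s, (Set.Ioi (0 : ℝ)).indicator
      (fun s => s * x ^ (s - 1) / Real.Gamma (s + 1)) s :=
  (integral_indicator measurableSet_Ioi).symm

@[fun_prop]
lemma measurable_volterraDeriv : Measurable volterraDeriv := by
  have := (measurable_uncurry_volterraDeriv_integrand.stronglyMeasurable.integral_prod_right'
    (ν := volume)).measurable
  convert this using 2 with x
  exact volterraDeriv_eq_integral_indicator x

lemma volterraDeriv_integrand_nonneg {x s : ℝ} (hx : 0 < x) :
    0 ≤ (Set.Ioi (0 : ℝ)).indicator (fun s => s * x ^ (s - 1) / Real.Gamma (s + 1)) s := by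
  refine Set.indicator_nonneg (fun s hs => ?_) s
  have hs : (0 : ℝ) < s := hs
  have := Real.Gamma_pos_of_pos (by linarith : 0 < s + 1)
  positivity

/-- The derivative of the Volterra function as a lower Lebesgue integral. -/
noncomputable def volterraDerivLIntegral (x : ℝ) : ENNReal :=
  ∫⁻ s, ENNReal.ofReal ((Set.Ioi (0 : ℝ)).indicator
    (fun s => s * x ^ (s - 1) / Real.Gamma (s + 1)) s)

lemma measurable_volterraDerivLIntegral : Measurable volterraDerivLIntegral :=
  measurable_uncurry_volterraDeriv_integrand.ennreal_ofReal.lintegral_prod_right'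

lemma volterraDeriv_eq_toReal {x : ℝ} (hx : 0 < x) :
    volterraDeriv x = (volterraDerivLIntegral x).toReal := by
  rw [volterraDeriv_eq_integral_indicator, integral_eq_lintegral_of_nonneg_ae]
  · rfl
  · exact Filter.Eventually.of_forall fun s => volterraDeriv_integrand_nonneg hx
  · exact (measurable_uncurry_volterraDeriv_integrand.comp
      (measurable_prodMk_left (x := x))).aestronglyMeasurable

lemma volterraDeriv_nonneg {x : ℝ} (hx : 0 < x) : 0 ≤ volterraDeriv x := by
  rw [volterraDeriv_eq_toReal hx]
  exact ENNReal.toReal_nonneg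

lemma lintegral_volterraDerivLIntegral_mul_exp {lam a : ℝ} (hlam : 0 < lam) (ha : lam < a) :
    ∫⁻ u in Set.Ioi 0, volterraDerivLIntegral (u * lam) * ENNReal.ofReal (exp (-(a * u)))
      = ENNReal.ofReal (1 / (lam * log (a / lam))) := by
  have ha0 : 0 < a := hlam.trans ha
  have hL : 0 < log (a / lam) := log_pos ((one_lt_div hlam).mpr ha)
  have h1 : ∀ u : ℝ, volterraDerivLIntegral (u * lam) * ENNReal.ofReal (exp (-(a * u)))
      = ∫⁻ s, ENNReal.ofReal ((Set.Ioi (0 : ℝ)).indicator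
        (fun s => s * (u * lam) ^ (s - 1) / Real.Gamma (s + 1)) s) *
          ENNReal.ofReal (exp (-(a * u))) := fun u => by
    rw [lintegral_mul_const']
    · rfl
    · exact ENNReal.ofReal_ne_top
  simp only [h1]
  have hm := measurable_uncurry_volterraDeriv_integrand
  rw [lintegral_lintegral_swap]
  swap
  · refine (Measurable.mul (f := fun p : ℝ × ℝ => ENNReal.ofReal ((Set.Ioi (0 : ℝ)).indicator
        (fun s => s * (p.1 * lam) ^ (s - 1) / Real.Gamma (s + 1)) p.2))
        (g := fun p : ℝ × ℝ => ENNReal.ofReal (exp (-(a * p.1)))) ?_ (by fun_prop)).aemeasurable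
    exact (hm.comp (f := fun p : ℝ × ℝ => (p.1 * lam, p.2)) (by fun_prop)).ennreal_ofReal
  have h2 : ∀ s : ℝ, ∫⁻ u in Set.Ioi 0, ENNReal.ofReal ((Set.Ioi (0 : ℝ)).indicator
        (fun s => s * (u * lam) ^ (s - 1) / Real.Gamma (s + 1)) s) *
          ENNReal.ofReal (exp (-(a * u)))
      = (Set.Ioi (0 : ℝ)).indicator
          (fun s => ENNReal.ofReal (1 / lam * exp (-log (a / lam) * s))) s := by
    intro s
    by_cases hs : s ∈ Set.Ioi (0 : ℝ)
    swap
    · simp [Set.indicator_of_notMem hs]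
    have hs0 : 0 < s := hs
    have hΓ := Real.Gamma_pos_of_pos hs0
    simp only [Set.indicator_of_mem hs]
    have hI := Real.integral_rpow_mul_exp_neg_mul_Ioi hs0 ha0
    have hint : IntegrableOn (fun u : ℝ => u ^ (s - 1) * exp (-(a * u))) (Set.Ioi 0) := by
      refine Integrable.of_integral_ne_zero ?_
      rw [hI]
      positivity
    have hval : 1 / lam * exp (-log (a / lam) * s) = ∫ u in Set.Ioi 0,
        lam ^ (s - 1) / Real.Gamma s * (u ^ (s - 1) * exp (-(a * u))) := by
      rw [integral_const_mul, hI, rpow_sub hlam, rpow_one, one_div a, inv_rpow ha0.le,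
        log_div ha0.ne' hlam.ne', neg_sub, sub_mul, exp_sub, ← rpow_def_of_pos hlam,
        ← rpow_def_of_pos ha0]
      field_simp
    rw [hval, ofReal_integral_eq_lintegral_ofReal (hint.const_mul _)]
    · refine setLIntegral_congr_fun measurableSet_Ioi fun u hu => ?_
      have hu : (0 : ℝ) < u := hu
      rw [← ENNReal.ofReal_mul' (exp_pos _).le, mul_rpow hu.le hlam.le,
        Real.Gamma_add_one hs0.ne']
      congr 1
      field_simp
    · filter_upwards [ae_restrict_mem measurableSet_Ioi] with u hu
      have hu : (0 : ℝ) < u := hu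
      simp only [Pi.zero_apply]
      positivity
  simp only [h2]
  rw [lintegral_indicator measurableSet_Ioi]
  have h3 := integral_exp_mul_Ioi (a := -log (a / lam)) (by linarith) 0
  rw [← ofReal_integral_eq_lintegral_ofReal]
  · rw [integral_const_mul, h3]
    congr 1
    simp
    ring
  · refine Integrable.const_mul (Integrable.of_integral_ne_zero ?_) _
    rw [h3]
    simp [hL.ne']
  · exact Filter.Eventually.of_forall fun s => by positivity

lemma ae_volterraDerivLIntegral_ne_top {lam : ℝ} (hlam : 0 < lam) :
    ∀ᵐ u ∂(volume.restrict (Set.Ioi (0 : ℝ))), volterraDerivLIntegral (u * lam) ≠ ⊤ := by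
  have h := lintegral_volterraDerivLIntegral_mul_exp hlam (a := 2 * lam) (by linarith)
  have h2 := ae_lt_top' (μ := volume.restrict (Set.Ioi (0 : ℝ)))
    (f := fun u => volterraDerivLIntegral (u * lam) * ENNReal.ofReal (exp (-(2 * lam * u))))
    (by
      have := measurable_volterraDerivLIntegral.comp (measurable_id.mul_const lam)
      exact (Measurable.mul this (by fun_prop)).aemeasurable)
    (by rw [h]; exact ENNReal.ofReal_ne_top)
  filter_upwards [h2] with u hu htop
  rw [htop, ENNReal.top_mul (by simpa using exp_pos _)] at hu
  exact lt_irrefl _ hu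

/-- The function `u ↦ ν′(λu)`, extended by zero to the nonpositive half-line. -/
noncomputable def volterraKer (lam u : ℝ) : ENNReal :=
  if 0 < u then ENNReal.ofReal (volterraDeriv (u * lam)) else 0

@[fun_prop]
lemma measurable_volterraKer (lam : ℝ) : Measurable (volterraKer lam) :=
  Measurable.ite measurableSet_Ioi (by fun_prop) measurable_const

lemma volterraKer_of_nonpos {lam u : ℝ} (hu : u ≤ 0) : volterraKer lam u = 0 :=
  if_neg hu.not_gt

lemma volterraKer_of_pos {lam u : ℝ} (hu : 0 < u) :
    volterraKer lam u = ENNReal.ofReal (volterraDeriv (u * lam)) :=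
  if_pos hu

/-- The Laplace transform of `u ↦ ν′(λu)`. -/
lemma lintegral_volterraKer_mul_exp {lam a : ℝ} (hlam : 0 < lam) (ha : lam < a) :
    ∫⁻ u, volterraKer lam u * ENNReal.ofReal (exp (-(a * u)))
      = ENNReal.ofReal (1 / (lam * log (a / lam))) := by
  rw [← lintegral_volterraDerivLIntegral_mul_exp hlam ha, ← lintegral_indicator measurableSet_Ioi]
  have h := (ae_restrict_iff' measurableSet_Ioi).mp (ae_volterraDerivLIntegral_ne_top hlam)
  refine lintegral_congr_ae ?_
  filter_upwards [h] with u hu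
  by_cases h0 : 0 < u
  · rw [Set.indicator_of_mem (by exact h0), volterraKer_of_pos h0,
      volterraDeriv_eq_toReal (by positivity), ENNReal.ofReal_toReal (hu h0)]
  · rw [Set.indicator_of_notMem (by exact h0), volterraKer_of_nonpos (not_lt.mp h0), zero_mul]

/-- The function `x ↦ exp (-a x)` on the positive half-line, extended by zero. -/
noncomputable def expKer (a x : ℝ) : ENNReal :=
  if 0 < x then ENNReal.ofReal (exp (-(a * x))) else 0

@[fun_prop]
lemma measurable_expKer : Measurable (fun p : ℝ × ℝ => expKer p.1 p.2) :=
  Measurable.ite (measurableSet_lt measurable_const measurable_snd) (by fun_prop) measurable_const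

@[fun_prop]
lemma Measurable.expKer {α : Type*} [MeasurableSpace α] {f g : α → ℝ} (hf : Measurable f)
    (hg : Measurable g) : Measurable (fun x => expKer (f x) (g x)) :=
  measurable_expKer.comp (hf.prodMk hg)

lemma expKer_of_pos (a : ℝ) {x : ℝ} (hx : 0 < x) :
    expKer a x = ENNReal.ofReal (exp (-(a * x))) := if_pos hx

lemma expKer_of_nonpos (a : ℝ) {x : ℝ} (hx : x ≤ 0) : expKer a x = 0 := if_neg hx.not_gt

lemma lintegral_mul_expKer (f : ℝ → ENNReal) (a : ℝ) :
    ∫⁻ x, f x * expKer a x = ∫⁻ x in Set.Ioi 0, f x * ENNReal.ofReal (exp (-(a * x))) := by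
  rw [← lintegral_indicator measurableSet_Ioi]
  refine lintegral_congr fun x => ?_
  by_cases hx : 0 < x
  · rw [Set.indicator_of_mem (by exact hx), expKer_of_pos a hx]
  · rw [Set.indicator_of_notMem (by exact hx), expKer_of_nonpos a (not_lt.mp hx), mul_zero]

lemma lintegral_expKer {a : ℝ} (ha : 0 < a) : ∫⁻ x, expKer a x = ENNReal.ofReal (1 / a) := by
  have h := lintegral_mul_expKer 1 a
  simp only [Pi.one_apply, one_mul] at h
  have h3 := integral_exp_mul_Ioi (a := -a) (by linarith) 0
  simp only [neg_mul, mul_zero, exp_zero, neg_div_neg_eq] at h3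
  rw [h, ← h3, ofReal_integral_eq_lintegral_ofReal]
  · refine Integrable.of_integral_ne_zero ?_
    rw [h3]
    positivity
  · exact Filter.Eventually.of_forall fun s => by positivity

/-- The kernel `λ / (x + y)` on the positive quadrant, extended by zero. -/
noncomputable def quadrantKer (lam x y : ℝ) : ENNReal :=
  if 0 < x ∧ 0 < y then ENNReal.ofReal (lam / (x + y)) else 0

lemma measurable_quadrantKer (lam : ℝ) :
    Measurable (fun p : ℝ × ℝ => quadrantKer lam p.1 p.2) :=
  Measurable.ite ((measurableSet_lt measurable_const measurable_fst).inter
    (measurableSet_lt measurable_const measurable_snd)) (by fun_prop) measurable_const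

@[fun_prop]
lemma Measurable.quadrantKer {α : Type*} [MeasurableSpace α] {f g : α → ℝ} (lam : ℝ)
    (hf : Measurable f) (hg : Measurable g) : Measurable (fun x => quadrantKer lam (f x) (g x)) :=
  (measurable_quadrantKer lam).comp (hf.prodMk hg)

lemma quadrantKer_mul_exp_eq_lintegral {lam : ℝ} (hlam : 0 < lam) (a b x y : ℝ) :
    quadrantKer lam x y * (ENNReal.ofReal (exp (-(a * x))) * ENNReal.ofReal (exp (-(b * y))))
      = ∫⁻ θ in Set.Ioi (0 : ℝ), ENNReal.ofReal lam * (expKer (a + θ) x * expKer (b + θ) y) := by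
  rw [quadrantKer]
  split_ifs with h
  · obtain ⟨hx, hy⟩ := h
    have h1 := lintegral_mul_expKer 1 (x + y)
    simp only [Pi.one_apply, one_mul] at h1
    rw [lintegral_expKer (by positivity)] at h1
    have h2 : ∀ θ : ℝ, ENNReal.ofReal lam * (expKer (a + θ) x * expKer (b + θ) y)
        = ENNReal.ofReal (lam * exp (-(a * x)) * exp (-(b * y)))
          * ENNReal.ofReal (exp (-((x + y) * θ))) := fun θ => by
      rw [expKer_of_pos _ hx, expKer_of_pos _ hy, ← ENNReal.ofReal_mul (by positivity),
        ← ENNReal.ofReal_mul (by positivity), ← ENNReal.ofReal_mul (by positivity)]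
      congr 1
      simp only [mul_assoc, ← exp_add]
      congr 2
      ring
    simp only [h2]
    rw [lintegral_const_mul' _ _ ENNReal.ofReal_ne_top, ← h1, ← ENNReal.ofReal_mul (by positivity),
      ← ENNReal.ofReal_mul (by positivity), ← ENNReal.ofReal_mul (by positivity)]
    congr 1
    ring
  · have h2 : ∀ θ : ℝ, expKer (a + θ) x * expKer (b + θ) y = 0 := fun θ => by
      rw [not_and_or, not_lt, not_lt] at h
      rcases h with h | h <;> simp [expKer_of_nonpos _ h]
    simp [h2]

lemma lintegral_one_div_mul_one_div {a b : ℝ} (ha : 0 < a) (hb : 0 < b) (hab : a ≠ b) :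
    ∫⁻ θ in Set.Ioi (0 : ℝ), ENNReal.ofReal (1 / (a + θ)) * ENNReal.ofReal (1 / (b + θ))
      = ENNReal.ofReal (log (b / a) / (b - a)) := by
  have hba : b - a ≠ 0 := sub_ne_zero.mpr hab.symm
  have hd : ∀ θ ∈ Set.Ici (0 : ℝ), HasDerivAt
      (fun θ => log ((a + θ) / (b + θ)) / (b - a)) (1 / (a + θ) * (1 / (b + θ))) θ := by
    intro θ hθ
    have hθ : (0 : ℝ) ≤ θ := hθ
    have h1 : HasDerivAt (fun θ => a + θ) 1 θ := (hasDerivAt_id θ).const_add a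
    have h2 : HasDerivAt (fun θ => b + θ) 1 θ := (hasDerivAt_id θ).const_add b
    have pa : a + θ ≠ 0 := by positivity
    have pb : b + θ ≠ 0 := by positivity
    refine (((h1.div h2 pb).log (div_ne_zero pa pb)).div_const (b - a)).congr_deriv ?_
    simp only [Pi.div_apply]
    field_simp
    ring
  have hlim : Filter.Tendsto (fun θ => log ((a + θ) / (b + θ)) / (b - a)) Filter.atTop
      (nhds 0) := by
    have h1 : Filter.Tendsto (fun θ : ℝ => 1 + (a - b) / (b + θ)) Filter.atTop (nhds (1 + 0)) :=
      tendsto_const_nhds.add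
        (Filter.Tendsto.const_div_atTop
          (Filter.tendsto_atTop_add_const_left _ _ Filter.tendsto_id) _)
    rw [add_zero] at h1
    have h2 := ((continuousAt_log one_ne_zero).tendsto.comp h1).div_const (b - a)
    rw [log_one, zero_div] at h2
    refine h2.congr' ?_
    filter_upwards [Filter.eventually_gt_atTop 0] with θ hθ
    simp only [Function.comp]
    congr 2
    field_simp
    ring
  have hnn : ∀ θ ∈ Set.Ioi (0 : ℝ), 0 ≤ 1 / (a + θ) * (1 / (b + θ)) := fun θ hθ => by
    have hθ : (0 : ℝ) < θ := hθ
    positivity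
  have hI := integral_Ioi_of_hasDerivAt_of_nonneg' hd hnn hlim
  have hint := integrableOn_Ioi_deriv_of_nonneg' hd hnn hlim
  have hval : log (b / a) / (b - a) = 0 - log ((a + 0) / (b + 0)) / (b - a) := by
    rw [add_zero, add_zero, log_div hb.ne' ha.ne', log_div ha.ne' hb.ne']
    ring
  rw [hval, ← hI, ofReal_integral_eq_lintegral_ofReal hint]
  · refine setLIntegral_congr_fun measurableSet_Ioi fun θ hθ => ?_
    have hθ : (0 : ℝ) < θ := hθ
    exact (ENNReal.ofReal_mul (by positivity)).symm
  · exact (ae_restrict_iff' measurableSet_Ioi).mpr (Filter.Eventually.of_forall hnn)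

lemma lintegral_lintegral_quadrantKer_mul_exp {lam a b : ℝ} (hlam : 0 < lam) (ha : 0 < a)
    (hb : 0 < b) (hab : a ≠ b) :
    ∫⁻ y, ∫⁻ x, quadrantKer lam x y *
        (ENNReal.ofReal (exp (-(a * x))) * ENNReal.ofReal (exp (-(b * y))))
      = ENNReal.ofReal (lam * (log (b / a) / (b - a))) := by
  simp only [quadrantKer_mul_exp_eq_lintegral hlam]
  have h1 : ∀ y : ℝ, ∫⁻ x, ∫⁻ θ in Set.Ioi (0 : ℝ),
      ENNReal.ofReal lam * (expKer (a + θ) x * expKer (b + θ) y)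
      = ∫⁻ θ in Set.Ioi (0 : ℝ), ∫⁻ x,
        ENNReal.ofReal lam * (expKer (a + θ) x * expKer (b + θ) y) := fun y => by
    rw [lintegral_lintegral_swap]
    exact Measurable.aemeasurable (by unfold Function.uncurry; fun_prop)
  simp only [h1]
  rw [lintegral_lintegral_swap]
  swap
  · refine Measurable.aemeasurable (Measurable.lintegral_prod_right'
      (f := fun p : (ℝ × ℝ) × ℝ => ENNReal.ofReal lam *
        (expKer (a + p.1.2) p.2 * expKer (b + p.1.2) p.1.1)) ?_)
    fun_prop
  rw [ENNReal.ofReal_mul hlam.le, ← lintegral_one_div_mul_one_div ha hb hab,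
    ← lintegral_const_mul' _ _ ENNReal.ofReal_ne_top]
  refine setLIntegral_congr_fun measurableSet_Ioi fun θ hθ => ?_
  have hθ : (0 : ℝ) < θ := hθ
  have e1 := lintegral_expKer (add_pos ha hθ)
  have e2 := lintegral_expKer (add_pos hb hθ)
  rw [← e1, ← e2]
  simp only [lintegral_const_mul' _ _ ENNReal.ofReal_ne_top]
  congr 1
  rw [← lintegral_const_mul' _ _ (by rw [e1]; exact ENNReal.ofReal_ne_top)]
  refine lintegral_congr fun y => ?_
  rw [lintegral_mul_const _ (by fun_prop)]

lemma volterraKer_ne_top (lam u : ℝ) : volterraKer lam u ≠ ⊤ := by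
  unfold volterraKer
  split_ifs <;> simp

lemma integrable_volterraKer_mul_exp {lam a : ℝ} (hlam : 0 < lam) (ha : lam < a) :
    Integrable (fun u => (volterraKer lam u).toReal * exp (-(a * u))) := by
  refine ⟨(by fun_prop : Measurable _).aestronglyMeasurable, ?_⟩
  rw [hasFiniteIntegral_iff_ofReal (Filter.Eventually.of_forall fun u => by positivity)]
  have h : ∀ u, ENNReal.ofReal ((volterraKer lam u).toReal * exp (-(a * u)))
      = volterraKer lam u * ENNReal.ofReal (exp (-(a * u))) := fun u => by
    rw [ENNReal.ofReal_mul ENNReal.toReal_nonneg, ENNReal.ofReal_toReal (volterraKer_ne_top _ _)]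
  simp only [h]
  rw [lintegral_volterraKer_mul_exp hlam ha]
  exact ENNReal.ofReal_lt_top

lemma integral_volterraKer_mul_exp {lam a : ℝ} (hlam : 0 < lam) (ha : lam < a) :
    ∫ u, (volterraKer lam u).toReal * exp (-(a * u)) = 1 / (lam * log (a / lam)) := by
  have hL : 0 < log (a / lam) := log_pos ((one_lt_div hlam).mpr ha)
  rw [integral_eq_lintegral_of_nonneg_ae (Filter.Eventually.of_forall fun u => by positivity)
    (by fun_prop : Measurable _).aestronglyMeasurable]
  have h : ∀ u, ENNReal.ofReal ((volterraKer lam u).toReal * exp (-(a * u)))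
      = volterraKer lam u * ENNReal.ofReal (exp (-(a * u))) := fun u => by
    rw [ENNReal.ofReal_mul ENNReal.toReal_nonneg, ENNReal.ofReal_toReal (volterraKer_ne_top _ _)]
  simp only [h]
  rw [lintegral_volterraKer_mul_exp hlam ha, ENNReal.toReal_ofReal (by positivity)]

lemma exp_sub_exp_div_nonneg (a b : ℝ) {c : ℝ} (hc : 0 ≤ c) :
    0 ≤ (exp (-(a * c)) - exp (-(b * c))) / (b - a) := by
  rcases le_total a b with h | h
  · refine div_nonneg (sub_nonneg.mpr (exp_le_exp.mpr ?_)) (sub_nonneg.mpr h)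
    nlinarith
  · refine div_nonneg_of_nonpos (sub_nonpos.mpr (exp_le_exp.mpr ?_)) (sub_nonpos.mpr h)
    nlinarith

lemma lintegral_expKer_mul_expKer_sub {a b c : ℝ} (hab : a ≠ b) (hc : 0 < c) :
    ∫⁻ x, expKer a x * expKer b (c - x)
      = ENNReal.ofReal ((exp (-(a * c)) - exp (-(b * c))) / (b - a)) := by
  have hba : b - a ≠ 0 := sub_ne_zero.mpr hab.symm
  have h1 : ∀ x, expKer a x * expKer b (c - x) = (Set.Ioo 0 c).indicator
      (fun x => ENNReal.ofReal (exp (-(a * x) - b * (c - x)))) x := fun x => by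
    by_cases hx : x ∈ Set.Ioo 0 c
    · rw [Set.indicator_of_mem hx, expKer_of_pos a hx.1, expKer_of_pos b (sub_pos.mpr hx.2),
        ← ENNReal.ofReal_mul (exp_pos _).le, ← exp_add]
      rfl
    · rw [Set.indicator_of_notMem hx]
      rw [Set.mem_Ioo, not_and_or, not_lt, not_lt] at hx
      rcases hx with hx | hx
      · rw [expKer_of_nonpos a hx, zero_mul]
      · rw [expKer_of_nonpos b (sub_nonpos.mpr hx), mul_zero]
  simp only [h1]
  rw [lintegral_indicator measurableSet_Ioo, Measure.restrict_congr_set Ioo_ae_eq_Ioc]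
  have hcont : Continuous fun x => exp (-(a * x) - b * (c - x)) := by fun_prop
  rw [← ofReal_integral_eq_lintegral_ofReal, ← intervalIntegral.integral_of_le hc.le,
    intervalIntegral.integral_eq_sub_of_hasDerivAt
      (f := fun x => exp (-(a * x) - b * (c - x)) / (b - a))]
  · congr 1
    simp only [sub_self, mul_zero, sub_zero, neg_zero, zero_sub]
    ring
  · intro x _
    have h2 : HasDerivAt (fun x => -(a * x) - b * (c - x)) (b - a) x := by
      have h3 : HasDerivAt (fun x : ℝ => x) 1 x := hasDerivAt_id x
      refine ((h3.const_mul a).neg.sub ((h3.const_sub c).const_mul b)).congr_deriv ?_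
      ring
    refine (h2.exp.div_const (b - a)).congr_deriv ?_
    field_simp
  · exact hcont.intervalIntegrable _ _
  · exact (hcont.integrableOn_Icc (a := 0) (b := c)).mono_set Set.Ioc_subset_Icc_self
  · exact Filter.Eventually.of_forall fun x => (exp_pos _).le

/-- The double Laplace transform of `(x, y) ↦ ν′(λ(x + y))`. -/
lemma lintegral_lintegral_volterraKer_add {lam a b : ℝ} (hlam : 0 < lam) (ha : lam < a)
    (hb : lam < b) (hab : a ≠ b) :
    ∫⁻ y, (∫⁻ x, volterraKer lam (x + y) * expKer a x) * expKer b y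
      = ENNReal.ofReal ((1 / (lam * log (a / lam)) - 1 / (lam * log (b / lam))) / (b - a)) := by
  have h1 : ∀ y, (∫⁻ x, volterraKer lam (x + y) * expKer a x) * expKer b y
      = ∫⁻ x, volterraKer lam (x + y) * expKer a x * expKer b y := fun y =>
    (lintegral_mul_const _ (by fun_prop)).symm
  simp only [h1]
  rw [lintegral_lintegral_swap
    (by unfold Function.uncurry; exact Measurable.aemeasurable (by fun_prop))]
  have h2 : ∀ x, ∫⁻ y, volterraKer lam (x + y) * expKer a x * expKer b y
      = ∫⁻ c, volterraKer lam c * (expKer a x * expKer b (c - x)) := fun x => by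
    rw [← lintegral_add_left_eq_self
      (fun c => volterraKer lam c * (expKer a x * expKer b (c - x))) x]
    simp only [add_sub_cancel_left, mul_assoc]
  simp only [h2]
  rw [lintegral_lintegral_swap
    (by unfold Function.uncurry; exact Measurable.aemeasurable (by fun_prop))]
  have h3 : ∀ c, ∫⁻ x, volterraKer lam c * (expKer a x * expKer b (c - x))
      = ENNReal.ofReal ((volterraKer lam c).toReal *
        ((exp (-(a * c)) - exp (-(b * c))) / (b - a))) := fun c => by
    rw [lintegral_const_mul _ (by fun_prop)]
    rcases le_or_gt c 0 with hc | hc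
    · simp [volterraKer_of_nonpos hc]
    · rw [lintegral_expKer_mul_expKer_sub hab hc, ENNReal.ofReal_mul ENNReal.toReal_nonneg,
        ENNReal.ofReal_toReal (volterraKer_ne_top _ _)]
  simp only [h3]
  have h4 : ∀ c, (volterraKer lam c).toReal * ((exp (-(a * c)) - exp (-(b * c))) / (b - a))
      = ((volterraKer lam c).toReal * exp (-(a * c))
        - (volterraKer lam c).toReal * exp (-(b * c))) / (b - a) := fun c => by ring
  rw [← ofReal_integral_eq_lintegral_ofReal]
  · simp only [h4]
    rw [integral_div, integral_sub (integrable_volterraKer_mul_exp hlam ha)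
      (integrable_volterraKer_mul_exp hlam hb), integral_volterraKer_mul_exp hlam ha,
      integral_volterraKer_mul_exp hlam hb]
  · simp only [h4]
    exact ((integrable_volterraKer_mul_exp hlam ha).sub
      (integrable_volterraKer_mul_exp hlam hb)).div_const _
  · refine Filter.Eventually.of_forall fun c => ?_
    rcases le_or_gt c 0 with hc | hc
    · simp [volterraKer_of_nonpos hc]
    · exact mul_nonneg ENNReal.toReal_nonneg (exp_sub_exp_div_nonneg a b hc.le)

/-- The overshoot integral `∫∫ ν′(λu) ν′(λv) λ / (x - u + y - v) du dv`. -/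
noncomputable def overshootKer (lam x y : ℝ) : ENNReal :=
  ∫⁻ v, ∫⁻ u, volterraKer lam u * volterraKer lam v * quadrantKer lam (x - u) (y - v)

lemma quadrantKer_of_not {lam x y : ℝ} (h : ¬ (0 < x ∧ 0 < y)) : quadrantKer lam x y = 0 :=
  if_neg h

lemma overshootKer_of_not {lam x y : ℝ} (h : ¬ (0 < x ∧ 0 < y)) : overshootKer lam x y = 0 := by
  have : ∀ u v, volterraKer lam u * volterraKer lam v * quadrantKer lam (x - u) (y - v) = 0 := by
    intro u v
    rcases le_or_gt u 0 with hu | hu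
    · simp [volterraKer_of_nonpos hu]
    rcases le_or_gt v 0 with hv | hv
    · simp [volterraKer_of_nonpos hv]
    rw [quadrantKer_of_not fun hq => h ⟨by linarith [hq.1], by linarith [hq.2]⟩, mul_zero]
  simp [overshootKer, this]

@[fun_prop]
lemma measurable_overshootKer (lam : ℝ) :
    Measurable (fun p : ℝ × ℝ => overshootKer lam p.1 p.2) := by
  unfold overshootKer
  refine Measurable.lintegral_prod_right' (f := fun p : (ℝ × ℝ) × ℝ => ∫⁻ u, volterraKer lam u *
    volterraKer lam p.2 * quadrantKer lam (p.1.1 - u) (p.1.2 - p.2)) ?_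
  refine Measurable.lintegral_prod_right' (f := fun q : ((ℝ × ℝ) × ℝ) × ℝ => volterraKer lam q.2 *
    volterraKer lam q.1.2 * quadrantKer lam (q.1.1.1 - q.2) (q.1.1.2 - q.1.2)) ?_
  fun_prop

lemma overshootKer_integrand_eq (lam a b x y u v : ℝ) :
    volterraKer lam u * volterraKer lam v * quadrantKer lam (x - u) (y - v)
        * (expKer a x * expKer b y)
      = (volterraKer lam u * ENNReal.ofReal (exp (-(a * u))))
        * (volterraKer lam v * ENNReal.ofReal (exp (-(b * v))))
        * (quadrantKer lam (x - u) (y - v) * (ENNReal.ofReal (exp (-(a * (x - u))))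
          * ENNReal.ofReal (exp (-(b * (y - v)))))) := by
  by_cases hq : 0 < x - u ∧ 0 < y - v
  swap
  · simp [quadrantKer_of_not hq]
  rcases le_or_gt u 0 with hu | hu
  · simp [volterraKer_of_nonpos hu]
  rcases le_or_gt v 0 with hv | hv
  · simp [volterraKer_of_nonpos hv]
  have e : ∀ c w z : ℝ, ENNReal.ofReal (exp (-(c * z)))
      = ENNReal.ofReal (exp (-(c * w))) * ENNReal.ofReal (exp (-(c * (z - w)))) := fun c w z => by
    rw [← ENNReal.ofReal_mul (exp_pos _).le, ← exp_add]
    congr 2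
    ring
  rw [expKer_of_pos a (by linarith [hq.1]), expKer_of_pos b (by linarith [hq.2]), e a u x, e b v y]
  ring

/-- The double Laplace transform of the overshoot integral. -/
lemma lintegral_lintegral_overshootKer {lam a b : ℝ} (hlam : 0 < lam) (ha : lam < a)
    (hb : lam < b) (hab : a ≠ b) :
    ∫⁻ y, (∫⁻ x, overshootKer lam x y * expKer a x) * expKer b y
      = ENNReal.ofReal (1 / (lam * log (a / lam))) * ENNReal.ofReal (1 / (lam * log (b / lam)))
        * ENNReal.ofReal (lam * (log (b / a) / (b - a))) := by
  set F : ℝ → ℝ → ℝ → ℝ → ENNReal := fun x y u v =>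
    volterraKer lam u * volterraKer lam v * quadrantKer lam (x - u) (y - v)
        * (expKer a x * expKer b y) with hF
  have mF : Measurable fun p : (ℝ × ℝ) × ℝ × ℝ => F p.1.1 p.1.2 p.2.1 p.2.2 := by fun_prop
  have h1 : ∀ y, (∫⁻ x, overshootKer lam x y * expKer a x) * expKer b y
      = ∫⁻ x, ∫⁻ p : ℝ × ℝ, F x y p.1 p.2 := fun y => by
    rw [← lintegral_mul_const _ (by fun_prop)]
    refine lintegral_congr fun x => ?_
    rw [Measure.volume_eq_prod, lintegral_prod_symm _ (by fun_prop), mul_assoc, overshootKer]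
    rw [← lintegral_mul_const _ (Measurable.lintegral_prod_right'
      (f := fun p : ℝ × ℝ => volterraKer lam p.2 * volterraKer lam p.1 *
        quadrantKer lam (x - p.2) (y - p.1)) (by fun_prop))]
    refine lintegral_congr fun v => ?_
    rw [← lintegral_mul_const _ (by fun_prop)]
  simp only [h1]
  have h2 : ∫⁻ y, ∫⁻ x, ∫⁻ p : ℝ × ℝ, F x y p.1 p.2
      = ∫⁻ p : ℝ × ℝ, ∫⁻ q : ℝ × ℝ, F q.1 q.2 p.1 p.2 := by
    rw [lintegral_lintegral_swap (f := fun p q : ℝ × ℝ => F q.1 q.2 p.1 p.2)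
      (by unfold Function.uncurry; exact Measurable.aemeasurable (by fun_prop)),
      Measure.volume_eq_prod, lintegral_prod_symm _ (Measurable.aemeasurable ?_)]
    exact Measurable.lintegral_prod_right' (f := fun p : (ℝ × ℝ) × ℝ × ℝ =>
      F p.1.1 p.1.2 p.2.1 p.2.2) mF
  have h3 : ∀ p : ℝ × ℝ, ∫⁻ q : ℝ × ℝ, F q.1 q.2 p.1 p.2
      = (volterraKer lam p.1 * ENNReal.ofReal (exp (-(a * p.1))))
        * (volterraKer lam p.2 * ENNReal.ofReal (exp (-(b * p.2))))
        * ENNReal.ofReal (lam * (log (b / a) / (b - a))) := fun p => by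
    simp only [hF, overshootKer_integrand_eq]
    rw [lintegral_const_mul _ (by fun_prop), ← lintegral_lintegral_quadrantKer_mul_exp hlam
      (hlam.trans ha) (hlam.trans hb) hab, Measure.volume_eq_prod,
      lintegral_prod_symm _ (Measurable.aemeasurable (by fun_prop))]
    congr 1
    rw [← lintegral_sub_right_eq_self (fun y => ∫⁻ x, quadrantKer lam x y *
      (ENNReal.ofReal (exp (-(a * x))) * ENNReal.ofReal (exp (-(b * y))))) p.2]
    refine lintegral_congr fun y => ?_
    exact lintegral_sub_right_eq_self (fun x => quadrantKer lam x (y - p.2) *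
      (ENNReal.ofReal (exp (-(a * x))) * ENNReal.ofReal (exp (-(b * (y - p.2)))))) p.1
  rw [h2]
  simp only [h3]
  rw [lintegral_mul_const _ (by fun_prop), Measure.volume_eq_prod, lintegral_prod_mul
    (f := fun u => volterraKer lam u * ENNReal.ofReal (exp (-(a * u))))
    (g := fun u => volterraKer lam u * ENNReal.ofReal (exp (-(b * u))))
    (Measurable.aemeasurable (by fun_prop)) (Measurable.aemeasurable (by fun_prop)),
    lintegral_volterraKer_mul_exp hlam ha, lintegral_volterraKer_mul_exp hlam hb]

lemma laplace_overshootKer_eq {lam a b : ℝ} (hlam : 0 < lam) (ha : lam < a)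
    (hb : lam < b) (hab : a ≠ b) :
    ∫⁻ y, (∫⁻ x, overshootKer lam x y * expKer a x) * expKer b y
      = ∫⁻ y, (∫⁻ x, volterraKer lam (x + y) * expKer a x) * expKer b y := by
  have hLa : 0 < log (a / lam) := log_pos ((one_lt_div hlam).mpr ha)
  have hLb : 0 < log (b / lam) := log_pos ((one_lt_div hlam).mpr hb)
  have hba : b - a ≠ 0 := sub_ne_zero.mpr hab.symm
  rw [lintegral_lintegral_overshootKer hlam ha hb hab,
    lintegral_lintegral_volterraKer_add hlam ha hb hab, ← ENNReal.ofReal_mul (by positivity),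
    ← ENNReal.ofReal_mul (by positivity)]
  congr 1
  have : log (b / a) = log (b / lam) - log (a / lam) := by
    rw [log_div (by linarith) (by linarith), log_div (by linarith) (by linarith),
      log_div (by linarith) (by linarith)]
    ring
  rw [this]
  field_simp

/-- The overshoot identity `∫∫ ν′(λu) ν′(λv) λ / (x - u + y - v) du dv = ν′(λ(x + y))`. -/
lemma ae_ae_overshootKer_eq {lam : ℝ} (hlam : 0 < lam) :
    ∀ᵐ y ∂(volume.restrict (Set.Ioi (0 : ℝ))), ∀ᵐ x ∂(volume.restrict (Set.Ioi (0 : ℝ))),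
      overshootKer lam x y = volterraKer lam (x + y) := by
  have mO := measurable_overshootKer lam
  set a : ℕ → ℝ := fun n => (lam + 1) + n with ha
  set b : ℕ → ℝ := fun n => (lam + 3 / 2) + n with hb
  have hal : ∀ n, lam < a n := fun n => by
    have : (0 : ℝ) ≤ n := n.cast_nonneg
    simp only [ha]; linarith
  have hbl : ∀ n, lam < b n := fun n => by
    have : (0 : ℝ) ≤ n := n.cast_nonneg
    simp only [hb]; linarith
  have hab : ∀ m n, a m ≠ b n := fun m n h => by
    simp only [ha, hb] at h
    have h2 : (2 * m : ℝ) = 2 * n + 1 := by linarith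
    have h3 : 2 * m = 2 * n + 1 := by exact_mod_cast h2
    omega
  have mL : ∀ m, Measurable fun y => ∫⁻ x, overshootKer lam x y * expKer (a m) x := fun m =>
    Measurable.lintegral_prod_right' (f := fun p : ℝ × ℝ =>
      overshootKer lam p.2 p.1 * expKer (a m) p.2)
      ((mO.comp measurable_swap).mul (by fun_prop))
  have mR : ∀ m, Measurable fun y => ∫⁻ x, volterraKer lam (x + y) * expKer (a m) x := fun m =>
    Measurable.lintegral_prod_right' (f := fun p : ℝ × ℝ =>
      volterraKer lam (p.2 + p.1) * expKer (a m) p.2) (by fun_prop)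
  have hfin : ∀ m n, ∫⁻ y, (∫⁻ x, overshootKer lam x y * expKer (a m) x) * expKer (b n) y ≠ ⊤ :=
    fun m n => by
      rw [laplace_overshootKer_eq hlam (hal m) (hbl n) (hab m n),
        lintegral_lintegral_volterraKer_add hlam (hal m) (hbl n) (hab m n)]
      exact ENNReal.ofReal_ne_top
  have hfin0 := hfin 0 0
  have h1 : ∀ m, ∀ᵐ y ∂(volume.restrict (Set.Ioi (0 : ℝ))),
      ∫⁻ x, overshootKer lam x y * expKer (a m) x
        = ∫⁻ x, volterraKer lam (x + y) * expKer (a m) x := fun m => by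
    refine ae_eq_of_forall_lintegral_exp_eq (mL m) (mR m) (lam + 3 / 2) ?_ fun n => ?_
    · rw [← lintegral_mul_expKer]
      simpa [hb] using hfin m 0
    · rw [← lintegral_mul_expKer, ← lintegral_mul_expKer]
      exact laplace_overshootKer_eq hlam (hal m) (hbl n) (hab m n)
  have h2 : ∀ᵐ y ∂(volume.restrict (Set.Ioi (0 : ℝ))),
      ∫⁻ x, overshootKer lam x y * expKer (a 0) x ≠ ⊤ := by
    have h3 := ae_lt_top ((mL 0).mul (by fun_prop : Measurable (expKer (b 0)))) hfin0
    filter_upwards [ae_restrict_of_ae h3, ae_restrict_mem measurableSet_Ioi] with y hy hy0 htop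
    have hy0 : (0 : ℝ) < y := hy0
    simp only [Pi.mul_apply] at hy
    rw [htop, expKer_of_pos _ hy0, ENNReal.top_mul (by simpa using exp_pos _)] at hy
    exact lt_irrefl _ hy
  filter_upwards [ae_all_iff.mpr h1, h2] with y hy hytop
  refine ae_eq_of_forall_lintegral_exp_eq (mO.comp measurable_prodMk_right) (by fun_prop)
    (lam + 1) ?_ fun m => ?_
  · rw [← lintegral_mul_expKer]
    simpa [ha] using hytop
  · rw [← lintegral_mul_expKer, ← lintegral_mul_expKer]
    exact hy m

lemma gauss2_nonneg {t : ℝ} (ht : 0 < t) (x : EuclideanSpace ℝ (Fin 2)) : 0 ≤ gauss2 t x := by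
  unfold gauss2
  positivity

lemma gauss2_neg (t : ℝ) (x : EuclideanSpace ℝ (Fin 2)) : gauss2 t (-x) = gauss2 t x := by
  simp [gauss2]

@[fun_prop]
lemma Measurable.gauss2 {α : Type*} [MeasurableSpace α] {f : α → ℝ}
    {g : α → EuclideanSpace ℝ (Fin 2)} (hf : Measurable f) (hg : Measurable g) :
    Measurable (fun a => gauss2 (f a) (g a)) := by
  unfold _root_.gauss2
  fun_prop

lemma gauss2_le {t : ℝ} (ht : 0 < t) {x : EuclideanSpace ℝ (Fin 2)} (hx : x ≠ 0) :
    gauss2 t x ≤ 1 / (π * ‖x‖ ^ 2) := by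
  have hx' : 0 < ‖x‖ := norm_pos_iff.mpr hx
  set k := ‖x‖ ^ 2 / (2 * t) with hk
  have hk0 : 0 < k := by positivity
  have h1 : exp (-k) ≤ 1 / k := by
    rw [exp_neg, ← one_div]
    exact one_div_le_one_div_of_le hk0 (by linarith [add_one_le_exp k])
  calc gauss2 t x = (1 / (2 * π * t)) * exp (-k) := rfl
    _ ≤ (1 / (2 * π * t)) * (1 / k) := by gcongr
    _ = 1 / (π * ‖x‖ ^ 2) := by rw [hk]; field_simp

/-- The product of two Gaussian densities, by completing the square. -/
lemma gauss2_mul_gauss2 {a b : ℝ} (ha : 0 < a) (hb : 0 < b) (x y z : EuclideanSpace ℝ (Fin 2)) :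
    gauss2 a (x - y) * gauss2 b (y - z) = gauss2 (a + b) (x - z) *
      ((a + b) / (2 * a * b) / π * exp (-((a + b) / (2 * a * b)) *
        ‖y - ((b / (a + b)) • x + (a / (a + b)) • z)‖ ^ 2)) := by
  unfold gauss2
  have hab : 0 < a + b := by positivity
  have h1 : ∀ p q r s : ℝ, p * exp q * (r * exp s) = p * r * exp (q + s) := fun p q r s => by
    rw [exp_add]; ring
  rw [h1, h1]
  congr 1
  · field_simp
  · congr 1
    simp only [EuclideanSpace.norm_sq_eq, Fin.sum_univ_two, Real.norm_eq_abs, sq_abs,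
      PiLp.sub_apply, PiLp.add_apply, PiLp.smul_apply, smul_eq_mul]
    field_simp
    ring

/-- The two-dimensional Gaussian density, extended by zero to nonpositive times. -/
noncomputable def gaussKer (t : ℝ) (x : EuclideanSpace ℝ (Fin 2)) : ENNReal :=
  if 0 < t then ENNReal.ofReal (gauss2 t x) else 0

lemma gaussKer_of_pos {t : ℝ} (ht : 0 < t) (x : EuclideanSpace ℝ (Fin 2)) :
    gaussKer t x = ENNReal.ofReal (gauss2 t x) := if_pos ht

lemma gaussKer_of_nonpos {t : ℝ} (ht : t ≤ 0) (x : EuclideanSpace ℝ (Fin 2)) :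
    gaussKer t x = 0 := if_neg ht.not_gt

lemma gaussKer_ne_top (t : ℝ) (x : EuclideanSpace ℝ (Fin 2)) : gaussKer t x ≠ ⊤ := by
  unfold gaussKer
  split_ifs <;> simp

lemma gaussKer_neg (t : ℝ) (x : EuclideanSpace ℝ (Fin 2)) : gaussKer t (-x) = gaussKer t x := by
  simp only [gaussKer, gauss2_neg]

@[fun_prop]
lemma Measurable.gaussKer {α : Type*} [MeasurableSpace α] {f : α → ℝ}
    {g : α → EuclideanSpace ℝ (Fin 2)} (hf : Measurable f) (hg : Measurable g) :
    Measurable (fun a => gaussKer (f a) (g a)) :=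
  Measurable.ite (measurableSet_lt measurable_const hf) (by fun_prop) measurable_const

/-- The Chapman–Kolmogorov equation for the Gaussian kernel. -/
lemma lintegral_gaussKer_mul_gaussKer {a b : ℝ} (ha : 0 < a) (hb : 0 < b)
    (x z : EuclideanSpace ℝ (Fin 2)) :
    ∫⁻ y, gaussKer a (x - y) * gaussKer b (y - z) = gaussKer (a + b) (x - z) := by
  have hab : 0 < a + b := by positivity
  set κ := (a + b) / (2 * a * b) with hκ
  have hκ0 : 0 < κ := by positivity
  have hI : ∫ y : EuclideanSpace ℝ (Fin 2), κ / π * exp (-κ * ‖y‖ ^ 2) = 1 := by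
    rw [integral_const_mul, GaussianFourier.integral_rexp_neg_mul_sq_norm hκ0]
    simp
    field_simp
  have hI2 : ∫⁻ y : EuclideanSpace ℝ (Fin 2), ENNReal.ofReal (κ / π * exp (-κ * ‖y‖ ^ 2)) = 1 := by
    rw [← ofReal_integral_eq_lintegral_ofReal, hI, ENNReal.ofReal_one]
    · exact Integrable.of_integral_ne_zero (by rw [hI]; exact one_ne_zero)
    · exact Filter.Eventually.of_forall fun y => by positivity
  simp only [gaussKer_of_pos ha, gaussKer_of_pos hb, gaussKer_of_pos hab]
  simp only [← ENNReal.ofReal_mul (gauss2_nonneg ha _), gauss2_mul_gauss2 ha hb,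
    ENNReal.ofReal_mul (gauss2_nonneg hab _)]
  rw [lintegral_const_mul _ (by fun_prop), lintegral_sub_right_eq_self
    (fun y : EuclideanSpace ℝ (Fin 2) => ENNReal.ofReal (κ / π * exp (-κ * ‖y‖ ^ 2))), hI2, mul_one]

lemma lintegral_gaussKer_mul_gaussKer_zero {a : ℝ} (ha : 0 < a) (r : ℝ)
    (x : EuclideanSpace ℝ (Fin 2)) :
    ∫⁻ y, gaussKer a (x - y) * gaussKer r y = if 0 < r then gaussKer (a + r) x else 0 := by
  split_ifs with hr
  · simpa using lintegral_gaussKer_mul_gaussKer ha hr x 0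
  · simp [gaussKer_of_nonpos (not_lt.mp hr)]

lemma const_mul_lintegral_gaussKer_mul_gaussKer {lam : ℝ} (hlam : 0 < lam) (a b : ℝ) :
    ENNReal.ofReal (2 * π * lam) * ∫⁻ y, gaussKer a y * gaussKer b y = quadrantKer lam a b := by
  by_cases h : 0 < a ∧ 0 < b
  · obtain ⟨ha, hb⟩ := h
    have h1 := lintegral_gaussKer_mul_gaussKer ha hb 0 0
    simp only [zero_sub, gaussKer_neg, sub_zero] at h1
    have h2 : 0 < a + b := by positivity
    rw [h1, gaussKer_of_pos h2, ← ENNReal.ofReal_mul (by positivity), quadrantKer, if_pos ⟨ha, hb⟩]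
    congr 1
    simp [gauss2]
    field_simp
  · rw [quadrantKer_of_not h]
    rw [not_and_or, not_lt, not_lt] at h
    rcases h with h | h <;> simp [gaussKer_of_nonpos h]

/-- The kernel `h_t^λ` as a lower Lebesgue integral over `ℝ²`. -/
noncomputable def hKerLIntegral (t lam : ℝ) (x y : EuclideanSpace ℝ (Fin 2)) : ENNReal :=
  ENNReal.ofReal (2 * π * lam) * ∫⁻ p : ℝ × ℝ,
    gaussKer p.1 x * volterraKer lam (p.2 - p.1) * gaussKer (t - p.2) y

lemma measurable_hKerLIntegral_left (t lam : ℝ) (y : EuclideanSpace ℝ (Fin 2)) :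
    Measurable fun x => hKerLIntegral t lam x y :=
  Measurable.const_mul (Measurable.lintegral_prod_right'
    (f := fun q : EuclideanSpace ℝ (Fin 2) × (ℝ × ℝ) => gaussKer q.2.1 q.1 *
      volterraKer lam (q.2.2 - q.2.1) * gaussKer (t - q.2.2) y) (by fun_prop)) _

lemma measurable_hKerLIntegral_right (t lam : ℝ) (x : EuclideanSpace ℝ (Fin 2)) :
    Measurable fun y => hKerLIntegral t lam x y :=
  Measurable.const_mul (Measurable.lintegral_prod_right'
    (f := fun q : EuclideanSpace ℝ (Fin 2) × (ℝ × ℝ) => gaussKer q.2.1 x *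
      volterraKer lam (q.2.2 - q.2.1) * gaussKer (t - q.2.2) q.1) (by fun_prop)) _

lemma gaussKer_le {t : ℝ} {x : EuclideanSpace ℝ (Fin 2)} (hx : x ≠ 0) :
    gaussKer t x ≤ ENNReal.ofReal (1 / (π * ‖x‖ ^ 2)) := by
  rcases le_or_gt t 0 with h | h
  · simp [gaussKer_of_nonpos h]
  · rw [gaussKer_of_pos h]
    exact ENNReal.ofReal_le_ofReal (gauss2_le h hx)

lemma hKerLIntegral_ne_top {lam : ℝ} (hlam : 0 < lam) (t : ℝ) {x y : EuclideanSpace ℝ (Fin 2)}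
    (hx : x ≠ 0) (hy : y ≠ 0) : hKerLIntegral t lam x y ≠ ⊤ := by
  refine ENNReal.mul_ne_top ENNReal.ofReal_ne_top (ne_top_of_le_ne_top (b :=
    ∫⁻ p : ℝ × ℝ, ENNReal.ofReal (1 / (π * ‖x‖ ^ 2)) * ENNReal.ofReal (1 / (π * ‖y‖ ^ 2)) *
      ENNReal.ofReal (exp (2 * lam * t)) * ((Set.Ioo 0 t).indicator 1 p.1 *
        (volterraKer lam (p.2 - p.1) * ENNReal.ofReal (exp (-(2 * lam * (p.2 - p.1))))))) ?_ ?_)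
  · have m1 : Measurable ((Set.Ioo 0 t).indicator (1 : ℝ → ENNReal)) :=
      measurable_one.indicator measurableSet_Ioo
    have m2 : Measurable fun p : ℝ × ℝ => (Set.Ioo 0 t).indicator (1 : ℝ → ENNReal) p.1 *
        (volterraKer lam (p.2 - p.1) * ENNReal.ofReal (exp (-(2 * lam * (p.2 - p.1))))) :=
      Measurable.mul (f := fun p : ℝ × ℝ => (Set.Ioo 0 t).indicator (1 : ℝ → ENNReal) p.1)
        (g := fun p : ℝ × ℝ =>
          volterraKer lam (p.2 - p.1) * ENNReal.ofReal (exp (-(2 * lam * (p.2 - p.1)))))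
        (m1.comp measurable_fst) (by fun_prop)
    rw [lintegral_const_mul' _ _ (by finiteness), Measure.volume_eq_prod,
      lintegral_prod _ m2.aemeasurable]
    refine ENNReal.mul_ne_top (by finiteness) ?_
    have h : ∀ r : ℝ, ∫⁻ s, (Set.Ioo 0 t).indicator (1 : ℝ → ENNReal) r *
        (volterraKer lam (s - r) * ENNReal.ofReal (exp (-(2 * lam * (s - r)))))
        = (Set.Ioo 0 t).indicator (1 : ℝ → ENNReal) r *
          ENNReal.ofReal (1 / (lam * log (2 * lam / lam))) := fun r => by
      rw [lintegral_const_mul _ (by fun_prop), lintegral_sub_right_eq_self (fun u =>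
        volterraKer lam u * ENNReal.ofReal (exp (-(2 * lam * u)))),
        lintegral_volterraKer_mul_exp hlam (by linarith)]
    simp only [h]
    rw [lintegral_mul_const _ m1, lintegral_indicator_one measurableSet_Ioo, Real.volume_Ioo]
    finiteness
  · refine lintegral_mono fun p => ?_
    by_cases hp : 0 < p.1 ∧ 0 < p.2 - p.1 ∧ 0 < t - p.2
    · obtain ⟨h1, h2, h3⟩ := hp
      rw [Set.indicator_of_mem (show p.1 ∈ Set.Ioo 0 t from ⟨h1, by linarith⟩), Pi.one_apply,
        one_mul]
      have h4 : 1 ≤ ENNReal.ofReal (exp (2 * lam * t)) *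
          ENNReal.ofReal (exp (-(2 * lam * (p.2 - p.1)))) := by
        rw [← ENNReal.ofReal_mul (exp_pos _).le, ← exp_add, ENNReal.one_le_ofReal]
        refine one_le_exp ?_
        have : 0 ≤ 2 * lam * (t - (p.2 - p.1)) := mul_nonneg (by linarith) (by linarith)
        linarith
      calc gaussKer p.1 x * volterraKer lam (p.2 - p.1) * gaussKer (t - p.2) y
          ≤ ENNReal.ofReal (1 / (π * ‖x‖ ^ 2)) * volterraKer lam (p.2 - p.1) *
            ENNReal.ofReal (1 / (π * ‖y‖ ^ 2)) * 1 := by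
            rw [mul_one]
            gcongr
            · exact gaussKer_le hx
            · exact gaussKer_le hy
        _ ≤ ENNReal.ofReal (1 / (π * ‖x‖ ^ 2)) * volterraKer lam (p.2 - p.1) *
            ENNReal.ofReal (1 / (π * ‖y‖ ^ 2)) * (ENNReal.ofReal (exp (2 * lam * t)) *
          ENNReal.ofReal (exp (-(2 * lam * (p.2 - p.1))))) := by gcongr
        _ = _ := by ring
    · have : gaussKer p.1 x * volterraKer lam (p.2 - p.1) * gaussKer (t - p.2) y = 0 := by
        simp only [not_and_or, not_lt] at hp
        rcases hp with h | h | h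
        · simp [gaussKer_of_nonpos h]
        · simp [volterraKer_of_nonpos h]
        · simp [gaussKer_of_nonpos h]
      rw [this]
      exact zero_le

lemma hKer_eq_toReal {lam : ℝ} (hlam : 0 < lam) (t : ℝ) {x y : EuclideanSpace ℝ (Fin 2)}
    (hx : x ≠ 0) (hy : y ≠ 0) : hKer t lam x y = (hKerLIntegral t lam x y).toReal := by
  have hc : 0 < 2 * π * lam := by positivity
  set Φ : ℝ → ℝ → ENNReal := fun r s =>
    gaussKer r x * volterraKer lam (s - r) * gaussKer (t - s) y with hΦ
  have mΦ : Measurable fun p : ℝ × ℝ => Φ p.1 p.2 := by fun_prop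
  have hfin : ∫⁻ r, ∫⁻ s, Φ r s ≠ ⊤ := by
    intro htop
    refine hKerLIntegral_ne_top hlam t hx hy ?_
    rw [hKerLIntegral, Measure.volume_eq_prod, lintegral_prod _ (by fun_prop)]
    refine (congrArg _ htop).trans (ENNReal.mul_top ?_)
    simpa using hc
  have hin : ∀ r ∈ Set.Ioo 0 t, ∫ s in Set.Ioo r t,
      gauss2 r x * volterraDeriv ((s - r) * lam) * gauss2 (t - s) y = (∫⁻ s, Φ r s).toReal := by
    intro r hr
    have hnn : ∀ s ∈ Set.Ioo r t,
        0 ≤ gauss2 r x * volterraDeriv ((s - r) * lam) * gauss2 (t - s) y := fun s hs =>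
      mul_nonneg (mul_nonneg (gauss2_nonneg hr.1 x)
        (volterraDeriv_nonneg (mul_pos (sub_pos.mpr hs.1) hlam)))
        (gauss2_nonneg (sub_pos.mpr hs.2) y)
    rw [integral_eq_lintegral_of_nonneg_ae
      ((ae_restrict_iff' measurableSet_Ioo).mpr (Filter.Eventually.of_forall hnn))
      (Measurable.aestronglyMeasurable (by fun_prop)), ← lintegral_indicator measurableSet_Ioo]
    congr 1
    refine lintegral_congr fun s => ?_
    by_cases hs : s ∈ Set.Ioo r t
    · have h1 := gauss2_nonneg hr.1 x
      have h2 := volterraDeriv_nonneg (mul_pos (sub_pos.mpr hs.1) hlam)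
      rw [Set.indicator_of_mem hs, hΦ, ENNReal.ofReal_mul (mul_nonneg h1 h2), ENNReal.ofReal_mul h1]
      simp only
      rw [gaussKer_of_pos hr.1, volterraKer_of_pos (sub_pos.mpr hs.1),
        gaussKer_of_pos (sub_pos.mpr hs.2)]
    · rw [Set.indicator_of_notMem hs]
      rw [Set.mem_Ioo, not_and_or, not_lt, not_lt] at hs
      rcases hs with hs | hs
      · simp [hΦ, volterraKer_of_nonpos (sub_nonpos.mpr hs)]
      · simp [hΦ, gaussKer_of_nonpos (sub_nonpos.mpr hs)]
  have hout : ∀ r ∉ Set.Ioo 0 t, ∫⁻ s, Φ r s = 0 := by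
    intro r hr
    have : ∀ s, Φ r s = 0 := fun s => by
      rw [Set.mem_Ioo, not_and_or, not_lt, not_lt] at hr
      rcases hr with hr | hr
      · simp [hΦ, gaussKer_of_nonpos hr]
      · rcases le_or_gt (s - r) 0 with h | h
        · simp [hΦ, volterraKer_of_nonpos h]
        · simp [hΦ, gaussKer_of_nonpos (by linarith : t - s ≤ 0)]
    simp [this]
  have mint : Measurable fun r => ∫⁻ s, Φ r s := Measurable.lintegral_prod_right' mΦ
  rw [hKer, hKerLIntegral, ENNReal.toReal_mul, ENNReal.toReal_ofReal hc.le,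
    setIntegral_congr_fun measurableSet_Ioo hin,
    integral_toReal mint.aemeasurable (ae_restrict_of_ae (ae_lt_top mint hfin)),
    Measure.volume_eq_prod, lintegral_prod _ (by fun_prop), ← lintegral_indicator measurableSet_Ioo]
  congr 2
  refine lintegral_congr fun r => ?_
  by_cases hr : r ∈ Set.Ioo 0 t
  · rw [Set.indicator_of_mem hr]
  · rw [Set.indicator_of_notMem hr]
    exact (hout r hr).symm

/-- The kernel `f_t^λ` with values in the extended nonnegative reals. -/
noncomputable def fKerLIntegral (t lam : ℝ) (x y : EuclideanSpace ℝ (Fin 2)) : ENNReal :=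
  gaussKer t (x - y) + hKerLIntegral t lam x y

lemma fKerLIntegral_ne_top {lam : ℝ} (hlam : 0 < lam) (t : ℝ) {x y : EuclideanSpace ℝ (Fin 2)}
    (hx : x ≠ 0) (hy : y ≠ 0) : fKerLIntegral t lam x y ≠ ⊤ :=
  ENNReal.add_ne_top.mpr ⟨gaussKer_ne_top _ _, hKerLIntegral_ne_top hlam t hx hy⟩

lemma fKer_eq_toReal {t lam : ℝ} (hlam : 0 < lam) (ht : 0 < t) {x y : EuclideanSpace ℝ (Fin 2)}
    (hx : x ≠ 0) (hy : y ≠ 0) : fKer t lam x y = (fKerLIntegral t lam x y).toReal := by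
  rw [fKer, fKerLIntegral, ENNReal.toReal_add (gaussKer_ne_top _ _)
    (hKerLIntegral_ne_top hlam t hx hy), hKer_eq_toReal hlam t hx hy, gaussKer_of_pos ht,
    ENNReal.toReal_ofReal (gauss2_nonneg ht _)]

lemma lintegral_gaussKer_mul_hKerLIntegral {t : ℝ} (ht : 0 < t) (T lam : ℝ)
    (x z : EuclideanSpace ℝ (Fin 2)) :
    ∫⁻ y, gaussKer t (x - y) * hKerLIntegral (T - t) lam y z = ENNReal.ofReal (2 * π * lam) *
      ∫⁻ p : ℝ × ℝ, if t < p.1 then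
        gaussKer p.1 x * volterraKer lam (p.2 - p.1) * gaussKer (T - p.2) z else 0 := by
  have h1 : ∀ y, gaussKer t (x - y) * hKerLIntegral (T - t) lam y z
      = ENNReal.ofReal (2 * π * lam) * ∫⁻ p : ℝ × ℝ, gaussKer t (x - y) * gaussKer p.1 y *
        (volterraKer lam (p.2 - p.1) * gaussKer (T - t - p.2) z) := fun y => by
    rw [hKerLIntegral, mul_left_comm, ← lintegral_const_mul _ (by fun_prop)]
    simp only [mul_assoc]
  simp only [h1]
  rw [lintegral_const_mul' _ _ ENNReal.ofReal_ne_top, lintegral_lintegral_swap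
    (by unfold Function.uncurry; exact Measurable.aemeasurable (by fun_prop)),
    ← lintegral_add_left_eq_self (fun p : ℝ × ℝ => if t < p.1 then
      gaussKer p.1 x * volterraKer lam (p.2 - p.1) * gaussKer (T - p.2) z else 0) (t, t)]
  congr 1
  refine lintegral_congr fun p => ?_
  rw [lintegral_mul_const _ (by fun_prop), lintegral_gaussKer_mul_gaussKer_zero ht]
  simp only [Prod.fst_add, Prod.snd_add, lt_add_iff_pos_right, add_sub_add_left_eq_sub]
  rw [sub_add_eq_sub_sub T]
  split_ifs
  · rw [mul_assoc]
  · rw [zero_mul]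

lemma lintegral_hKerLIntegral_mul_gaussKer {t T : ℝ} (htT : t < T) (lam : ℝ)
    (x z : EuclideanSpace ℝ (Fin 2)) :
    ∫⁻ y, hKerLIntegral t lam x y * gaussKer (T - t) (y - z) = ENNReal.ofReal (2 * π * lam) *
      ∫⁻ p : ℝ × ℝ, if p.2 < t then
        gaussKer p.1 x * volterraKer lam (p.2 - p.1) * gaussKer (T - p.2) z else 0 := by
  have h1 : ∀ y, hKerLIntegral t lam x y * gaussKer (T - t) (y - z)
      = ENNReal.ofReal (2 * π * lam) * ∫⁻ p : ℝ × ℝ, gaussKer p.1 x * volterraKer lam (p.2 - p.1) *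
        (gaussKer (T - t) (z - y) * gaussKer (t - p.2) y) := fun y => by
    rw [hKerLIntegral, mul_assoc, ← lintegral_mul_const _ (by fun_prop), ← neg_sub z y,
      gaussKer_neg]
    simp only [mul_assoc, mul_comm (gaussKer (T - t) (z - y))]
  simp only [h1]
  rw [lintegral_const_mul' _ _ ENNReal.ofReal_ne_top, lintegral_lintegral_swap
    (by unfold Function.uncurry; exact Measurable.aemeasurable (by fun_prop))]
  congr 1
  refine lintegral_congr fun p => ?_
  rw [lintegral_const_mul _ (by fun_prop), lintegral_gaussKer_mul_gaussKer_zero (sub_pos.mpr htT)]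
  simp only [sub_pos, sub_add_sub_cancel, mul_ite, mul_zero]

lemma ae_overshootKer_eq {lam : ℝ} (hlam : 0 < lam) (t : ℝ) :
    ∀ᵐ s, ∀ᵐ r, overshootKer lam (t - r) s
      = if r < t ∧ 0 < s then volterraKer lam (t - r + s) else 0 := by
  have h := (ae_restrict_iff' measurableSet_Ioi).mp (ae_ae_overshootKer_eq hlam)
  filter_upwards [h] with s hs
  by_cases hs0 : 0 < s
  · have h2 := (ae_restrict_iff' measurableSet_Ioi).mp (hs hs0)
    have h3 := (Measure.measurePreserving_sub_left volume t).quasiMeasurePreserving.ae h2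
    filter_upwards [h3] with r hr
    by_cases hrt : r < t
    · rw [hr (sub_pos.mpr hrt), if_pos ⟨hrt, hs0⟩]
    · rw [if_neg fun h => hrt h.1]
      exact overshootKer_of_not fun h => hrt (sub_pos.mp h.1)
  · refine Filter.Eventually.of_forall fun r => ?_
    rw [if_neg fun h => hs0 h.2]
    exact overshootKer_of_not fun h => hs0 h.2

lemma lintegral_hKerLIntegral_mul_hKerLIntegral {lam : ℝ} (hlam : 0 < lam) (t T : ℝ)
    (x z : EuclideanSpace ℝ (Fin 2)) :
    ∫⁻ y, hKerLIntegral t lam x y * hKerLIntegral (T - t) lam y z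
      = ENNReal.ofReal (2 * π * lam) * ∫⁻ p : ℝ × ℝ, if p.1 < t ∧ t < p.2 then
        gaussKer p.1 x * volterraKer lam (p.2 - p.1) * gaussKer (T - p.2) z else 0 := by
  set c := ENNReal.ofReal (2 * π * lam) with hc
  set Φ : ℝ → ℝ → ℝ → ℝ → ENNReal := fun r s r' s' => gaussKer r x * gaussKer (T - t - s') z *
    (volterraKer lam (s - r) * volterraKer lam (s' - r') * quadrantKer lam (t - s) r') with hΦ
  have h1 : ∀ y, hKerLIntegral t lam x y * hKerLIntegral (T - t) lam y z
      = c * ∫⁻ p : ℝ × ℝ, ∫⁻ q : ℝ × ℝ, gaussKer p.1 x * gaussKer (T - t - q.2) z *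
        (volterraKer lam (p.2 - p.1) * volterraKer lam (q.2 - q.1)) *
        (c * (gaussKer (t - p.2) y * gaussKer q.1 y)) := fun y => by
    rw [hKerLIntegral, mul_assoc, ← lintegral_mul_const _ (by fun_prop)]
    congr 1
    refine lintegral_congr fun p => ?_
    rw [hKerLIntegral, ← lintegral_const_mul _ (by fun_prop), ← lintegral_const_mul _ (by fun_prop)]
    refine lintegral_congr fun q => ?_
    ring
  have h2 : ∫⁻ y, hKerLIntegral t lam x y * hKerLIntegral (T - t) lam y z
      = c * ∫⁻ p : ℝ × ℝ, ∫⁻ q : ℝ × ℝ, Φ p.1 p.2 q.1 q.2 := by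
    simp only [h1]
    rw [lintegral_const_mul' _ _ ENNReal.ofReal_ne_top, lintegral_lintegral_swap
      (Measurable.aemeasurable (Measurable.lintegral_prod_right'
        (f := fun w : (EuclideanSpace ℝ (Fin 2) × (ℝ × ℝ)) × (ℝ × ℝ) =>
        gaussKer w.1.2.1 x * gaussKer (T - t - w.2.2) z *
        (volterraKer lam (w.1.2.2 - w.1.2.1) * volterraKer lam (w.2.2 - w.2.1)) *
        (c * (gaussKer (t - w.1.2.2) w.1.1 * gaussKer w.2.1 w.1.1))) (by fun_prop)))]
    congr 1
    refine lintegral_congr fun p => ?_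
    rw [lintegral_lintegral_swap
      (by unfold Function.uncurry; exact Measurable.aemeasurable (by fun_prop))]
    refine lintegral_congr fun q => ?_
    rw [lintegral_const_mul _ (by fun_prop), lintegral_const_mul _ (by fun_prop),
      const_mul_lintegral_gaussKer_mul_gaussKer hlam, mul_assoc]
  have h3 : ∀ r, ∫⁻ s, ∫⁻ q : ℝ × ℝ, Φ r s q.1 q.2
      = ∫⁻ s', gaussKer r x * gaussKer (T - t - s') z * overshootKer lam (t - r) s' := fun r => by
    have h4 : ∀ s, ∫⁻ q : ℝ × ℝ, Φ r s q.1 q.2 = ∫⁻ s', ∫⁻ r', Φ r s r' s' := fun s => by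
      rw [Measure.volume_eq_prod, lintegral_prod_symm _ (by fun_prop)]
    simp only [h4]
    rw [lintegral_lintegral_swap (Measurable.aemeasurable (Measurable.lintegral_prod_right'
      (f := fun w : (ℝ × ℝ) × ℝ => Φ r w.1.1 w.2 w.1.2) (by fun_prop)))]
    refine lintegral_congr fun s' => ?_
    rw [lintegral_lintegral_swap
      (by unfold Function.uncurry; exact Measurable.aemeasurable (by fun_prop)),
      ← lintegral_sub_left_eq_self (fun r' => ∫⁻ s, Φ r s r' s') s', overshootKer,
      ← lintegral_const_mul _ (Measurable.lintegral_prod_right' (f := fun p : ℝ × ℝ =>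
        volterraKer lam p.2 * volterraKer lam p.1 * quadrantKer lam (t - r - p.2) (s' - p.1))
        (by fun_prop))]
    refine lintegral_congr fun v => ?_
    rw [← lintegral_add_left_eq_self (fun s => Φ r s (s' - v) s') r,
      ← lintegral_const_mul _ (by fun_prop)]
    simp only [hΦ, add_sub_cancel_left, sub_sub_cancel, sub_add_eq_sub_sub]
  have mO := measurable_overshootKer lam
  rw [h2, Measure.volume_eq_prod, lintegral_prod _ (Measurable.aemeasurable
    (Measurable.lintegral_prod_right' (f := fun w : (ℝ × ℝ) × (ℝ × ℝ) =>
      Φ w.1.1 w.1.2 w.2.1 w.2.2) (by fun_prop))), ← Measure.volume_eq_prod]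
  simp only [h3]
  have m1 : Measurable fun p : ℝ × ℝ => gaussKer p.1 x * gaussKer (T - t - p.2) z *
      overshootKer lam (t - p.1) p.2 :=
    Measurable.mul (f := fun p : ℝ × ℝ => gaussKer p.1 x * gaussKer (T - t - p.2) z)
      (g := fun p : ℝ × ℝ => overshootKer lam (t - p.1) p.2) (by fun_prop)
      (mO.comp (by fun_prop : Measurable fun p : ℝ × ℝ => (t - p.1, p.2)))
  rw [lintegral_lintegral_swap m1.aemeasurable]
  have h5 : ∫⁻ s', ∫⁻ r, gaussKer r x * gaussKer (T - t - s') z * overshootKer lam (t - r) s'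
      = ∫⁻ s', ∫⁻ r, gaussKer r x * gaussKer (T - t - s') z *
        if r < t ∧ 0 < s' then volterraKer lam (t - r + s') else 0 := by
    refine lintegral_congr_ae ?_
    filter_upwards [ae_overshootKer_eq hlam t] with s hs
    refine lintegral_congr_ae ?_
    filter_upwards [hs] with r hr
    rw [hr]
  have m2 : Measurable fun p : ℝ × ℝ => if p.1 < t ∧ t < p.2 then
        gaussKer p.1 x * volterraKer lam (p.2 - p.1) * gaussKer (T - p.2) z else 0 :=
    Measurable.ite ((measurableSet_lt measurable_fst measurable_const).inter
      (measurableSet_lt measurable_const measurable_snd)) (by fun_prop) measurable_const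
  rw [h5, ← lintegral_sub_right_eq_self _ t, Measure.volume_eq_prod,
    lintegral_prod_symm _ m2.aemeasurable]
  congr 1
  refine lintegral_congr fun s => lintegral_congr fun r => ?_
  simp only [sub_pos, sub_sub_sub_cancel_right, sub_add_sub_cancel', mul_ite, mul_zero]
  split_ifs
  · ring
  · rfl

/-- The semigroup property of the kernels `f_t^λ`, as lower Lebesgue integrals. -/
lemma lintegral_fKerLIntegral_mul_fKerLIntegral {lam t T : ℝ} (hlam : 0 < lam) (ht : 0 < t)
    (htT : t < T) (x z : EuclideanSpace ℝ (Fin 2)) :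
    ∫⁻ y, fKerLIntegral t lam x y * fKerLIntegral (T - t) lam y z = fKerLIntegral T lam x z := by
  have m1 := measurable_hKerLIntegral_right t lam x
  have m2 := measurable_hKerLIntegral_left (T - t) lam z
  set φ : ℝ × ℝ → ENNReal := fun p =>
    gaussKer p.1 x * volterraKer lam (p.2 - p.1) * gaussKer (T - p.2) z with hφ
  have mφ : Measurable φ := by fun_prop
  have k1 : Measurable fun p : ℝ × ℝ => if t < p.1 then φ p else 0 :=
    Measurable.ite (measurableSet_lt measurable_const measurable_fst) mφ measurable_const
  have k2 : Measurable fun p : ℝ × ℝ => if p.2 < t then φ p else 0 :=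
    Measurable.ite (measurableSet_lt measurable_snd measurable_const) mφ measurable_const
  have key : ∫⁻ p, φ p = (∫⁻ p, if t < p.1 then φ p else 0) + (∫⁻ p, if p.2 < t then φ p else 0)
      + ∫⁻ p, if p.1 < t ∧ t < p.2 then φ p else 0 := by
    rw [← lintegral_add_left k1, ← lintegral_add_left
      (f := fun p : ℝ × ℝ => (if t < p.1 then φ p else 0) + if p.2 < t then φ p else 0)
      (Measurable.add (f := fun p : ℝ × ℝ => if t < p.1 then φ p else 0)
        (g := fun p : ℝ × ℝ => if p.2 < t then φ p else 0) k1 k2)]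
    refine lintegral_congr_ae ?_
    have n1 : ∀ᵐ p : ℝ × ℝ, p.1 ≠ t :=
      Measure.quasiMeasurePreserving_fst.ae (Measure.ae_ne volume t)
    have n2 : ∀ᵐ p : ℝ × ℝ, p.2 ≠ t :=
      Measure.quasiMeasurePreserving_snd.ae (Measure.ae_ne volume t)
    filter_upwards [n1, n2] with p h1 h2
    by_cases hp : p.1 < p.2
    · rcases lt_or_gt_of_ne h1 with h1 | h1 <;> rcases lt_or_gt_of_ne h2 with h2 | h2
      · simp [h1, h2, h1.not_gt, h2.not_gt]
      · simp [h1, h2, h1.not_gt, h2.not_gt]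
      · exact absurd (h2.trans h1) hp.not_gt
      · simp [h1, h2, h1.not_gt, h2.not_gt]
    · have : φ p = 0 := by
        simp [hφ, volterraKer_of_nonpos (sub_nonpos.mpr (not_lt.mp hp))]
      simp [this]
  have h1 : ∀ y, fKerLIntegral t lam x y * fKerLIntegral (T - t) lam y z
      = (gaussKer t (x - y) * gaussKer (T - t) (y - z) +
          gaussKer t (x - y) * hKerLIntegral (T - t) lam y z) +
        (hKerLIntegral t lam x y * gaussKer (T - t) (y - z) +
          hKerLIntegral t lam x y * hKerLIntegral (T - t) lam y z) := fun y => by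
    rw [fKerLIntegral, fKerLIntegral]
    ring
  simp only [h1]
  rw [lintegral_add_left (by fun_prop), lintegral_add_left (by fun_prop),
    lintegral_add_left (by fun_prop), lintegral_gaussKer_mul_gaussKer ht (sub_pos.mpr htT),
    lintegral_gaussKer_mul_hKerLIntegral ht, lintegral_hKerLIntegral_mul_gaussKer htT,
    lintegral_hKerLIntegral_mul_hKerLIntegral hlam, add_sub_cancel, fKerLIntegral, hKerLIntegral,
    key]
  ring

/-- Semigroup property of the kernels `f_t^λ`: for all `λ > 0`, `0 < t < T` and nonzero
`x, z ∈ ℝ²`, `∫_{ℝ²} f_t^λ(x,y) f_{T−t}^λ(y,z) dy = f_T^λ(x,z)`. -/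
theorem fKer_semigroup (lam t T : ℝ) (hlam : 0 < lam) (ht : 0 < t) (htT : t < T)
    (x z : EuclideanSpace ℝ (Fin 2)) (hx : x ≠ 0) (hz : z ≠ 0) :
    (∫ y : EuclideanSpace ℝ (Fin 2), fKer t lam x y * fKer (T - t) lam y z)
      = fKer T lam x z := by
  have m1 := measurable_hKerLIntegral_right t lam x
  have m2 := measurable_hKerLIntegral_left (T - t) lam z
  have mF : Measurable fun y => fKerLIntegral t lam x y * fKerLIntegral (T - t) lam y z := by
    unfold fKerLIntegral
    fun_prop
  have hne : ∀ᵐ y : EuclideanSpace ℝ (Fin 2), y ≠ 0 := Measure.ae_ne volume 0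
  have h1 : ∀ᵐ y, fKer t lam x y * fKer (T - t) lam y z
      = (fKerLIntegral t lam x y * fKerLIntegral (T - t) lam y z).toReal := by
    filter_upwards [hne] with y hy
    rw [ENNReal.toReal_mul, fKer_eq_toReal hlam ht hx hy,
      fKer_eq_toReal hlam (sub_pos.mpr htT) hy hz]
  have h2 : ∀ᵐ y, fKerLIntegral t lam x y * fKerLIntegral (T - t) lam y z < ⊤ := by
    filter_upwards [hne] with y hy
    exact ENNReal.mul_lt_top (fKerLIntegral_ne_top hlam t hx hy).lt_top
      (fKerLIntegral_ne_top hlam (T - t) hy hz).lt_top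
  rw [integral_congr_ae h1, integral_toReal mF.aemeasurable h2,
    lintegral_fKerLIntegral_mul_fKerLIntegral hlam ht htT,
    fKer_eq_toReal hlam (ht.trans htT) hx hz]
end
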